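/- arXiv:1402.1569 — 4 statements merged into one kernel-verified Lean document; each statement's English description precedes it below -/
import Mathlib

section
/- Let l be an even positive integer. Then for every multi-index n⃗ ∈ ℕ^r and every j ∈ {1, …, r}, the Hankel determinant of multiple Hermite polynomials satisfies (−1)^{l(l−1)/2} · det( H_{n⃗+(i+k)e⃗_j}(x) )_{i,k=0}^{l−1} > 0 for all x ∈ ℝ. -/
open MeasureTheory Polynomial Finset

/-- `P` is the multiple Hermite polynomial for the (pairwise distinct) parameters `c`
and the multi-index `n`: it is monic of degree `|n|` and satisfies
`∫ x^k P(x) exp(-x² + c j x) dx = 0` for all `k < n j` and all `j`. -/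
def IsMultipleHermite {r : ℕ} (c : Fin r → ℝ) (n : Fin r → ℕ)
    (P : Polynomial ℝ) : Prop :=
  P.Monic ∧ P.natDegree = ∑ i, n i ∧
    ∀ j : Fin r, ∀ k < n j,
      ∫ x : ℝ, x ^ k * P.eval x * Real.exp (-x ^ 2 + c j * x) = 0

/-- The `j`-th standard unit multi-index `e⃗_j` in `ℕ^r`. -/
def unitMI {r : ℕ} (j : Fin r) : Fin r → ℕ := fun i => if i = j then 1 else 0

noncomputable def opA (t b : ℝ) : Module.End ℝ ℝ[X] :=
  LinearMap.mulLeft ℝ (X - C b) + t • derivative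

lemma opA_apply (t b : ℝ) (f : ℝ[X]) : opA t b f = (X - C b) * f + C t * derivative f := by
  simp [opA, smul_eq_C_mul]

noncomputable def TT (t : ℝ) (f : ℝ[X]) : ℝ[X] := aeval (opA t 0) f 1

lemma aeval_sub (t b : ℝ) : aeval (opA t 0) (X - C b) = opA t b := by
  refine LinearMap.ext fun f => ?_
  simp [opA_apply, Algebra.algebraMap_eq_smul_one, smul_eq_C_mul]
  ring

lemma TT_mul (t : ℝ) (p f : ℝ[X]) : TT t (p * f) = aeval (opA t 0) p (TT t f) := by
  simp [TT]

lemma TT_pow (t b : ℝ) (i : ℕ) (f : ℝ[X]) :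
    TT t ((X - C b) ^ i * f) = (opA t b ^ i) (TT t f) := by
  rw [TT_mul, map_pow, aeval_sub]

lemma TT_add (t : ℝ) (p f : ℝ[X]) : TT t (p + f) = TT t p + TT t f := by
  simp [TT]

lemma TT_C_mul (t a : ℝ) (f : ℝ[X]) : TT t (C a * f) = C a * TT t f := by
  simp [TT, Algebra.algebraMap_eq_smul_one, smul_eq_C_mul]

lemma TT_one (t : ℝ) : TT t 1 = 1 := by simp [TT]

lemma TT_C (t a : ℝ) : TT t (C a) = C a := by
  have := TT_C_mul t a 1
  simpa [TT_one] using this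

lemma TT_sum {ι : Type*} (t : ℝ) (s : Finset ι) (f : ι → ℝ[X]) :
    TT t (∑ i ∈ s, f i) = ∑ i ∈ s, TT t (f i) := by
  simp [TT]

lemma TT_X_mul (t : ℝ) (f : ℝ[X]) : TT t (X * f) = X * TT t f + C t * derivative (TT t f) := by
  have := TT_pow t 0 1 f
  simpa [opA_apply] using this

lemma poly_ind {P : ℝ[X] → Prop} (h0 : ∀ a, P (C a)) (hadd : ∀ p q, P p → P q → P (p + q))
    (hX : ∀ p, P p → P (X * p)) (f : ℝ[X]) : P f := by
  induction f using Polynomial.induction_on with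
  | C a => exact h0 a
  | add p q hp hq => exact hadd p q hp hq
  | monomial n a h =>
    have := hX _ h
    convert this using 1
    ring

lemma TT_derivative (t : ℝ) (f : ℝ[X]) : TT t (derivative f) = derivative (TT t f) := by
  induction f using poly_ind with
  | h0 a => 
    have := TT_C t 0
    simp at this
    simp [TT_C, this]
  | hadd p q hp hq => simp [TT_add, hp, hq]
  | hX p hp =>
    simp only [derivative_mul, derivative_X, TT_add, TT_X_mul, hp, derivative_add, derivative_C]
    ring

lemma TT_inv (t : ℝ) (f : ℝ[X]) : TT t (TT (-t) f) = f := by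
  induction f using poly_ind with
  | h0 a => simp [TT_C]
  | hadd p q hp hq => simp [TT_add, hp, hq]
  | hX p hp =>
    rw [TT_X_mul, TT_add, TT_X_mul, TT_C_mul, TT_derivative, hp]
    simp

lemma TT_deg (t : ℝ) (m : ℕ) : ∀ f : ℝ[X], f.natDegree ≤ m →
    (TT t f).natDegree ≤ m ∧ (TT t f).coeff m = f.coeff m := by
  induction m with
  | zero =>
    intro f hf
    rw [Polynomial.eq_C_of_natDegree_le_zero hf, TT_C]
    simp
  | succ m ih =>
    intro f hf
    have hd : (divX f).natDegree ≤ m := by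
      rw [natDegree_divX_eq_natDegree_tsub_one]; omega
    obtain ⟨h1, h2⟩ := ih _ hd
    have e : f = X * divX f + C (f.coeff 0) := (X_mul_divX_add f).symm
    have h3 : (TT t f) = X * TT t (divX f) + C t * derivative (TT t (divX f)) + C (f.coeff 0) := by
      conv_lhs => rw [e]
      rw [TT_add, TT_C, TT_X_mul]
    have h4 : (derivative (TT t (divX f))).natDegree ≤ m := 
      (natDegree_derivative_le _).trans (by omega)
    constructor
    · rw [h3]
      compute_degree
      omega
    · rw [h3]
      simp only [coeff_add, coeff_X_mul, h2, coeff_C_mul, coeff_C_succ, coeff_divX]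
      rw [coeff_eq_zero_of_natDegree_lt (by omega : (derivative (TT t (divX f))).natDegree < m + 1)]
      simp

lemma TT_natDegree (t : ℝ) (f : ℝ[X]) : (TT t f).natDegree = f.natDegree := by
  apply le_antisymm (TT_deg t _ f le_rfl).1
  have := (TT_deg (-t) _ (TT t f) le_rfl).1
  have h := TT_inv (-t) f
  rw [neg_neg] at h
  rwa [h] at this

lemma TT_monic (t : ℝ) (f : ℝ[X]) (hf : f.Monic) : (TT t f).Monic := by
  rw [Monic, leadingCoeff, TT_natDegree, (TT_deg t _ f le_rfl).2]
  exact hf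

lemma TT_ne_zero (t : ℝ) (f : ℝ[X]) (hf : f ≠ 0) : TT t f ≠ 0 := by
  intro h
  have h' := TT_inv (-t) f
  rw [neg_neg, h] at h'
  apply hf
  rw [← h']
  simpa using TT_C (-t) 0

/-- evaluation of iterates on multiples of `(X-x)^l`. -/
lemma opA_pow_eval (t b x : ℝ) (l : ℕ) : ∀ h : ℝ[X],
    ((opA t b ^ l) ((X - C x) ^ l * h)).eval x = t ^ l * l.factorial * h.eval x := by
  induction l with
  | zero => intro h; simp
  | succ m ih =>
    intro h
    have : opA t b ((X - C x) ^ (m + 1) * h) = (X - C x) ^ m *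
        ((X - C b) * ((X - C x) * h) + C t * (C ((m : ℝ) + 1) * h + (X - C x) * derivative h)) := by
      rw [opA_apply, derivative_mul, derivative_X_sub_C_pow]
      simp
      ring
    rw [pow_succ, Module.End.mul_apply, this, ih]
    simp [Nat.factorial_succ]
    ring

lemma opA_dvd (t b x : ℝ) (ht : t ≠ 0) (G : ℝ[X]) (l : ℕ)
    (hG : ∀ i < l, ((opA t b ^ i) G).eval x = 0) : (X - C x) ^ l ∣ G := by
  induction l with
  | zero => simp
  | succ m ih =>
    obtain ⟨h, rfl⟩ := ih (fun i hi => hG i (by omega))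
    have := hG m (by omega)
    rw [opA_pow_eval] at this
    have h0 : h.eval x = 0 := by
      have := Nat.factorial_ne_zero m
      simp_all
    rw [pow_succ]
    exact mul_dvd_mul_left _ (dvd_iff_isRoot.2 h0)

lemma integrable_poly_gauss (y : ℝ) (g : ℝ[X]) :
    Integrable (fun u : ℝ => g.eval u * Real.exp (-(u - y) ^ 2)) := by
  have h0 : ∀ g : ℝ[X], Integrable (fun u : ℝ => g.eval u * Real.exp (-u ^ 2)) := by
    intro g
    induction g using Polynomial.induction_on' with
    | add p q hp hq =>
      simp only [eval_add, add_mul]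
      exact hp.add hq
    | monomial n a =>
      have := (integrable_rpow_mul_exp_neg_mul_sq (b := 1) one_pos (s := n) 
        (by have : (0:ℝ) ≤ n := by positivity
            linarith)).const_mul a
      simpa [mul_assoc] using this
  have := (h0 (g.comp (X + C y))).comp_sub_right y
  simpa using this

lemma integral_poly_gauss (y : ℝ) : ∀ (m : ℕ) (g : ℝ[X]), g.natDegree ≤ m → 
    ∫ u : ℝ, g.eval u * Real.exp (-(u - y) ^ 2) = √Real.pi * (TT (1/2) g).eval y := by
  intro m
  have hC : ∀ a : ℝ, ∫ u : ℝ, (C a).eval u * Real.exp (-(u - y) ^ 2) 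
      = √Real.pi * (TT (1/2) (C a)).eval y := by
    intro a
    rw [TT_C]
    simp only [eval_C]
    rw [integral_const_mul, integral_sub_right_eq_self (fun u => Real.exp (-u ^ 2)) y]
    have := integral_gaussian 1
    simp at this
    rw [this, mul_comm]
  induction m with
  | zero =>
    intro g hg
    rw [Polynomial.eq_C_of_natDegree_le_zero hg]
    exact hC _
  | succ m ih =>
    intro g hg
    have hd : (divX g).natDegree ≤ m := by
      rw [natDegree_divX_eq_natDegree_tsub_one]; omega
    set f := divX g with hf
    have e : g = X * f + C (g.coeff 0) := (X_mul_divX_add g).symm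
    have h4 : (derivative f).natDegree ≤ m := 
      (natDegree_derivative_le _).trans (by omega)
    have hz : ∫ u : ℝ, (derivative f - C 2 * (X - C y) * f).eval u * Real.exp (-(u - y) ^ 2) = 0 := by
      apply integral_eq_zero_of_hasDerivAt_of_integrable 
        (f := fun u => f.eval u * Real.exp (-(u - y) ^ 2))
      · intro u
        have h1 := f.hasDerivAt u
        have h2 : HasDerivAt (fun u : ℝ => Real.exp (-(u - y) ^ 2)) 
          (Real.exp (-(u - y) ^ 2) * (-(2 * (u - y)))) u := by
          have := (((hasDerivAt_id u).sub_const y).pow 2).neg.exp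
          simpa using this
        refine (h1.mul h2).congr_deriv ?_
        simp only [eval_sub, eval_mul, eval_C, eval_X]
        ring
      · exact integrable_poly_gauss y _
      · exact integrable_poly_gauss y _
    have hsplit : ∀ u : ℝ, g.eval u * Real.exp (-(u - y) ^ 2) = 
       (y * (f.eval u * Real.exp (-(u - y) ^ 2)) + 1/2 * ((derivative f).eval u * Real.exp (-(u - y) ^ 2))
        - 1/2 * ((derivative f - C 2 * (X - C y) * f).eval u * Real.exp (-(u - y) ^ 2)))
        + (C (g.coeff 0)).eval u * Real.exp (-(u - y) ^ 2) := by
      intro u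
      conv_lhs => rw [e]
      simp
      ring
    simp_rw [hsplit]
    have i1 := (integrable_poly_gauss y f).const_mul y
    have i2 := (integrable_poly_gauss y (derivative f)).const_mul (1/2)
    have i3 := (integrable_poly_gauss y (derivative f - C 2 * (X - C y) * f)).const_mul (1/2)
    have i4 := (integrable_poly_gauss y (C (g.coeff 0)))
    rw [integral_add (by exact (i1.add i2).sub i3) i4, integral_sub (by exact i1.add i2) i3, integral_add i1 i2,
      integral_const_mul, integral_const_mul, integral_const_mul, hz, hC, ih f hd, ih _ h4]
    conv_rhs => rw [e]
    rw [TT_add, TT_X_mul, TT_derivative]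
    simp
    ring

lemma TT_pos (g : ℝ[X]) (hg : g ≠ 0) (hnn : ∀ u, 0 ≤ g.eval u) (y : ℝ) :
    0 < (TT (1/2) g).eval y := by
  have h := integral_poly_gauss y _ g le_rfl
  have hp : 0 < ∫ u : ℝ, g.eval u * Real.exp (-(u - y) ^ 2) := by
    obtain ⟨z, hz⟩ : ∃ z, g.eval z ≠ 0 := by
      by_contra! hh
      exact hg (Polynomial.funext (by simpa using hh))
    refine integral_pos_of_integrable_nonneg_nonzero (x := z) (by fun_prop)
      (integrable_poly_gauss y g) (fun u => ?_) ?_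
    · exact mul_nonneg (hnn u) (Real.exp_pos _).le
    · exact mul_ne_zero hz (Real.exp_pos _).ne'
  rw [h] at hp
  exact pos_of_mul_pos_right hp (by positivity)

lemma opA_natDegree (t b : ℝ) (p : ℝ[X]) (hp : p ≠ 0) : opA t b p ≠ 0 := by
  intro h
  rw [opA_apply] at h
  have h1 := congrArg (fun q => coeff q (p.natDegree + 1)) h
  have h4 : (derivative p).natDegree < p.natDegree + 1 :=
      (natDegree_derivative_le _).trans_lt (by omega)
  simp only [coeff_add, sub_mul, coeff_sub, coeff_X_mul, coeff_C_mul, coeff_zero,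
    coeff_eq_zero_of_natDegree_lt h4,
    coeff_eq_zero_of_natDegree_lt (Nat.lt_succ_self p.natDegree)] at h1
  simp at h1
  exact hp h1

lemma rolle_distinct (b : ℝ) (p : ℝ[X]) (hp : p ≠ 0) :
    p.roots.toFinset.card ≤ ((opA (1/2) b p).roots.toFinset \ p.roots.toFinset).card + 1 := by
  have hp' := opA_natDegree (1/2) b p hp
  refine Finset.card_le_sdiff_of_interleaved fun x hx y hy hxy hxy' => ?_
  rw [Multiset.mem_toFinset, mem_roots hp] at hx hy
  have hd : ∀ z : ℝ, HasDerivAt (fun z => Real.exp (z ^ 2 - 2 * b * z) * p.eval z)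
      (2 * Real.exp (z ^ 2 - 2 * b * z) * (opA (1/2) b p).eval z) z := by
    intro z
    have h2 : HasDerivAt (fun u : ℝ => Real.exp (u ^ 2 - 2 * b * u))
          (Real.exp (z ^ 2 - 2 * b * z) * (2 * z - 2 * b)) z := by
      have := (((hasDerivAt_id z).pow 2).sub ((hasDerivAt_id z).const_mul (2 * b))).exp
      simpa using this
    refine (h2.mul (p.hasDerivAt z)).congr_deriv ?_
    rw [opA_apply]
    simp only [eval_add, eval_sub, eval_mul, eval_C, eval_X]
    ring
  obtain ⟨z, hz1, hz2⟩ := exists_hasDerivAt_eq_zero hxy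
    (fun z _ => (hd z).continuousAt.continuousWithinAt)
    (by rw [IsRoot.def] at hx hy; simp [hx, hy]) (fun z _ => hd z)
  refine ⟨z, ?_, hz1⟩
  rw [Multiset.mem_toFinset, mem_roots hp', IsRoot.def]
  have := Real.exp_pos (z ^ 2 - 2 * b * z)
  simpa [this.ne'] using hz2

lemma opA_mult (t b x : ℝ) (p : ℝ[X]) (hp : p ≠ 0) :
    p.rootMultiplicity x - 1 ≤ (opA t b p).rootMultiplicity x := by
  rw [le_rootMultiplicity_iff (opA_natDegree t b p hp), opA_apply]
  have h1 : (X - C x) ^ (p.rootMultiplicity x - 1) ∣ p :=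
    (pow_dvd_pow _ (Nat.sub_le _ _)).trans (pow_rootMultiplicity_dvd p x)
  have h2 : (X - C x) ^ (p.rootMultiplicity x - 1) ∣ derivative p :=
    pow_sub_one_dvd_derivative_of_pow_dvd (pow_rootMultiplicity_dvd p x)
  exact dvd_add (h1.mul_left _) (h2.mul_left _)

lemma rolle (b : ℝ) (p : ℝ[X]) (hp : p ≠ 0) :
    Multiset.card p.roots ≤ Multiset.card (opA (1/2) b p).roots + 1 :=
  calc
    Multiset.card p.roots = ∑ x ∈ p.roots.toFinset, p.roots.count x :=
      (Multiset.toFinset_sum_count_eq _).symm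
    _ = ∑ x ∈ p.roots.toFinset, (p.roots.count x - 1 + 1) :=
      (Eq.symm <| Finset.sum_congr rfl fun _ hx => tsub_add_cancel_of_le <|
        Nat.succ_le_iff.2 <| Multiset.count_pos.2 <| Multiset.mem_toFinset.1 hx)
    _ = (∑ x ∈ p.roots.toFinset, (p.rootMultiplicity x - 1)) + p.roots.toFinset.card := by
      simp only [Finset.sum_add_distrib, Finset.card_eq_sum_ones, count_roots]
    _ ≤ (∑ x ∈ p.roots.toFinset, (opA (1/2) b p).rootMultiplicity x) +
          (((opA (1/2) b p).roots.toFinset \ p.roots.toFinset).card + 1) :=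
      (add_le_add
        (Finset.sum_le_sum fun _ _ => opA_mult _ _ _ _ hp)
        (rolle_distinct b p hp))
    _ ≤ (∑ x ∈ p.roots.toFinset, (opA (1/2) b p).roots.count x) +
          ((∑ x ∈ (opA (1/2) b p).roots.toFinset \ p.roots.toFinset,
            (opA (1/2) b p).roots.count x) + 1) := by
      simp only [← count_roots, Finset.card_eq_sum_ones]
      gcongr with x hx
      rw [Nat.succ_le_iff, Multiset.count_pos, ← Multiset.mem_toFinset]
      exact (Finset.mem_sdiff.1 hx).1
    _ = Multiset.card (opA (1/2) b p).roots + 1 := by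
      rw [← add_assoc, ← Finset.sum_union Finset.disjoint_sdiff, Finset.union_sdiff_self_eq_union, ←
        Multiset.toFinset_sum_count_eq, ← Finset.sum_subset Finset.subset_union_right]
      intro x _ hx₂
      simpa only [Multiset.mem_toFinset, Multiset.count_eq_zero] using hx₂

lemma rolle_iter (s : Multiset ℝ) (G : ℝ[X]) (hG : G ≠ 0) :
    Multiset.card (TT (1/2) G).roots ≤
      Multiset.card (TT (1/2) ((s.map fun b => X - C b).prod * G)).roots + Multiset.card s := by
  induction s using Multiset.induction_on with
  | empty => simp
  | cons b s ih =>
    have hne : (s.map fun b => X - C b).prod * G ≠ 0 :=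
      mul_ne_zero (monic_multiset_prod_of_monic _ _ fun a _ => monic_X_sub_C a).ne_zero hG
    have h := rolle b _ (TT_ne_zero (1/2) _ hne)
    have h2 := TT_pow (1/2) b 1 ((s.map fun b => X - C b).prod * G)
    rw [pow_one, pow_one] at h2
    rw [← h2] at h
    rw [Multiset.map_cons, Multiset.prod_cons, Multiset.card_cons, mul_assoc]
    omega

lemma const_sign (h : ℝ[X]) (h0 : ∀ x, h.eval x ≠ 0) :
    (∀ x, 0 ≤ h.eval x) ∨ (∀ x, 0 ≤ (-h).eval x) := by
  by_contra! hh
  obtain ⟨⟨a, ha⟩, b, hb⟩ := hh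
  rw [eval_neg] at hb
  obtain ⟨z, hz⟩ := mem_range_of_exists_le_of_exists_ge h.continuous ⟨a, ha.le⟩
    ⟨b, by linarith⟩
  exact h0 z hz

/-- The key variation-diminishing bound. -/
lemma key (l : ℕ) (hl : Even l) (x : ℝ) (h : ℝ[X]) (hh : h ≠ 0) :
    Multiset.card (TT (1/2) ((X - C x) ^ l * h)).roots ≤ h.natDegree := by
  obtain ⟨q, hq, hdeg, hroots⟩ := exists_prod_multiset_X_sub_C_mul h
  set P := (h.roots.map fun b => X - C b).prod with hP
  have hPne : P ≠ 0 := (monic_multiset_prod_of_monic _ _ fun a _ => monic_X_sub_C a).ne_zero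
  have hqne : q ≠ 0 := by rintro rfl; simp at hq; exact hh hq.symm
  have hxne : (X - C x) ^ l ≠ 0 := pow_ne_zero _ (X_sub_C_ne_zero x)
  have hit := rolle_iter h.roots ((X - C x) ^ l * h) (mul_ne_zero hxne hh)
  rw [← hP] at hit
  have hq0 : ∀ y, q.eval y ≠ 0 := by
    intro y hy
    have : y ∈ q.roots := (mem_roots hqne).2 hy
    rw [hroots] at this
    simp at this
  have hne : P * ((X - C x) ^ l * h) ≠ 0 := mul_ne_zero hPne (mul_ne_zero hxne hh)
  have hev : ∀ y, (P * ((X - C x) ^ l * h)).eval y = (y - x) ^ l * (P.eval y) ^ 2 * q.eval y := by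
    intro y
    conv_lhs => rw [← hq]
    simp
    ring
  have hzero : (TT (1/2) (P * ((X - C x) ^ l * h))).roots = 0 := by
    rw [Multiset.eq_zero_iff_forall_notMem]
    intro y hy
    have hy := isRoot_of_mem_roots hy
    rw [IsRoot.def] at hy
    rcases const_sign q hq0 with hs | hs
    · have := TT_pos _ hne (fun u => by
        rw [hev]; exact mul_nonneg (mul_nonneg (hl.pow_nonneg _) (sq_nonneg _)) (hs u)) y
      linarith
    · have := TT_pos _ (neg_ne_zero.2 hne) (fun u => by
        rw [eval_neg, hev, ← mul_neg, ← eval_neg]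
        exact mul_nonneg (mul_nonneg (hl.pow_nonneg _) (sq_nonneg _)) (hs u)) y
      have e := TT_C_mul (1/2) (-1) (P * ((X - C x) ^ l * h))
      simp only [map_neg, map_one, neg_mul, one_mul] at e
      rw [e, eval_neg] at this
      linarith
  rw [hzero] at hit
  have := h.card_roots'
  simp at hit
  simp
  omega

noncomputable def hankM (x b : ℝ) (l : ℕ) (W : ℝ[X]) : Matrix (Fin l) (Fin l) ℝ :=
  Matrix.of fun i k => (TT (-(1/2)) ((X - C b) ^ ((i : ℕ) + (k : ℕ)) * W)).eval x

lemma hankM_det_ne (x b : ℝ) (l : ℕ) (hl : Even l) (W : ℝ[X]) (hW : W ≠ 0)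
    (hs : Multiset.card W.roots = W.natDegree) : (hankM x b l W).det ≠ 0 := by
  intro h0
  obtain ⟨v, hv, hMv⟩ := Matrix.exists_mulVec_eq_zero_iff.2 h0
  obtain ⟨k0, hk0⟩ := Function.ne_iff.1 hv
  set q : ℝ[X] := ∑ k : Fin l, C (v k) * (X - C b) ^ (k : ℕ) with hq
  have hqne : q ≠ 0 := by
    intro hz
    have h1 : q.comp (X + C b) = ∑ k : Fin l, C (v k) * X ^ (k : ℕ) := by
      rw [← coe_compRingHom_apply, hq, map_sum]
      simp
    have h2 := congrArg (fun p => coeff p (k0 : ℕ)) h1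
    simp only [hz, zero_comp, coeff_zero, finsetSum_coeff, coeff_C_mul, coeff_X_pow] at h2
    rw [Finset.sum_eq_single k0] at h2
    · simp at h2; exact hk0 h2.symm
    · intro k _ hk
      have : (k0 : ℕ) ≠ k := fun e => hk (Fin.ext e.symm)
      simp [this]
    · simp
  have hqdeg : q.natDegree ≤ l - 1 := by
    apply natDegree_sum_le_of_forall_le
    intro k _
    refine (natDegree_C_mul_le _ _).trans ?_
    rw [natDegree_pow, natDegree_X_sub_C]
    have := k.2
    omega
  have hqW : q * W ≠ 0 := mul_ne_zero hqne hW
  set G := TT (-(1/2)) (q * W) with hG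
  have hdvd : (X - C x) ^ l ∣ G := by
    apply opA_dvd (-(1/2)) b x (by norm_num)
    intro i hi
    rw [hG, ← TT_pow, hq, Finset.sum_mul, Finset.mul_sum, TT_sum, eval_finsetSum]
    have h1 := congrFun hMv ⟨i, hi⟩
    simp only [Matrix.mulVec, dotProduct, hankM, Matrix.of_apply, Pi.zero_apply] at h1
    rw [← h1]
    refine Finset.sum_congr rfl fun k _ => ?_
    rw [show (X - C b) ^ i * (C (v k) * (X - C b) ^ (k : ℕ) * W)
      = C (v k) * ((X - C b) ^ (i + (k : ℕ)) * W) by ring, TT_C_mul, eval_mul, eval_C, mul_comm]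
  obtain ⟨h, hh⟩ := hdvd
  have hGne : G ≠ 0 := TT_ne_zero _ _ hqW
  have hne : h ≠ 0 := by rintro rfl; simp at hh; exact hGne hh
  have hdeg : G.natDegree = l + h.natDegree := by
    rw [hh, natDegree_mul (pow_ne_zero _ (X_sub_C_ne_zero x)) hne, natDegree_pow, natDegree_X_sub_C,
      mul_one]
  have hdeg2 : G.natDegree = q.natDegree + W.natDegree := by
    rw [hG, TT_natDegree, natDegree_mul hqne hW]
  have hk := key l hl x h hne
  rw [← hh, hG, TT_inv, roots_mul hqW, Multiset.card_add, hs] at hk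
  have := k0.2
  omega

lemma hankM_step (x b y ε : ℝ) (l : ℕ) (hl : Even l) (W : ℝ[X]) (hW : W ≠ 0)
    (hs : W.Splits) (hpos : 0 < ε * (hankM x b l W).det) :
    0 < ε * (hankM x b l ((X - C y) * W)).det := by
  set L : ℝ → ℝ[X] := fun τ => C (1 - τ) * (X - C y) + C τ with hL
  have hLne : ∀ τ, L τ ≠ 0 := by
    intro τ h
    have h1 := congrArg (fun p => eval (y + 1) p) h
    have h2 := congrArg (fun p => eval y p) h
    simp [hL] at h1 h2
  have hLs : ∀ τ, (L τ).Splits := by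
    intro τ
    apply Splits.of_natDegree_le_one
    simp only [hL]
    compute_degree
  have hne : ∀ τ, (hankM x b l (L τ * W)).det ≠ 0 := fun τ =>
    hankM_det_ne x b l hl _ (mul_ne_zero (hLne τ) hW) ((hLs τ).mul hs).natDegree_eq_card_roots.symm
  have hε : ε ≠ 0 := by rintro rfl; simp at hpos
  have hcont : Continuous fun τ => ε * (hankM x b l (L τ * W)).det := by
    refine continuous_const.mul (Continuous.matrix_det ?_)
    refine continuous_matrix fun i k => ?_
    have : ∀ τ, hankM x b l (L τ * W) i k =
        (1 - τ) * hankM x b l ((X - C y) * W) i k + τ * hankM x b l W i k := by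
      intro τ
      simp only [hankM, Matrix.of_apply, hL]
      rw [show (X - C b) ^ ((i : ℕ) + (k : ℕ)) * ((C (1 - τ) * (X - C y) + C τ) * W) =
        C (1 - τ) * ((X - C b) ^ ((i : ℕ) + (k : ℕ)) * ((X - C y) * W)) +
        C τ * ((X - C b) ^ ((i : ℕ) + (k : ℕ)) * W) by ring, TT_add, TT_C_mul, TT_C_mul]
      simp
    simp only [this]
    fun_prop
  by_contra! hneg
  have h0 : L 0 = X - C y := by simp [hL]
  have h1 : L 1 = 1 := by simp [hL]
  obtain ⟨z, hz⟩ := mem_range_of_exists_le_of_exists_ge hcont (c := 0)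
    ⟨0, by rw [h0]; exact hneg⟩ ⟨1, by rw [h1, one_mul]; exact hpos.le⟩
  exact mul_ne_zero hε (hne z) hz

lemma hankM_base (x b : ℝ) (l : ℕ) :
    0 < (-1 : ℝ) ^ (l * (l - 1) / 2) * (hankM x b l 1).det := by
  set Q : ℕ → ℝ[X] := fun i => TT (1/2) ((X - C x) ^ i) with hQ
  have hQm : ∀ i, (Q i).Monic := fun i => TT_monic _ _ ((monic_X_sub_C x).pow i)
  have hQd : ∀ i, (Q i).natDegree = i := fun i => by
    simp only [hQ]
    rw [TT_natDegree, natDegree_pow, natDegree_X_sub_C, mul_one]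
  have hU := Matrix.det_matrixOfPolynomials (n := l) (fun i : Fin l => taylor b (Q i))
    (fun i => by rw [natDegree_taylor, hQd]) (fun i => by rw [Monic, leadingCoeff_taylor]; exact hQm i)
  set U : Matrix (Fin l) (Fin l) ℝ := Matrix.of fun i j => (taylor b (Q j)).coeff i with hUd
  set N : Matrix (Fin l) (Fin l) ℝ :=
    Matrix.of fun i k => ((opA (-(1/2)) b ^ (i : ℕ)) ((X - C x) ^ (k : ℕ))).eval x with hN
  have hNU : N = hankM x b l 1 * U := by
    ext i k
    rw [Matrix.mul_apply]
    have e1 : (X - C x) ^ (k : ℕ) = TT (-(1/2)) (Q k) := by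
      have := TT_inv (-(1/2)) ((X - C x) ^ (k : ℕ))
      rw [neg_neg] at this
      exact this.symm
    have e2 : Q k = ∑ j : Fin l, C ((taylor b (Q k)).coeff j) * (X - C b) ^ (j : ℕ) := by
      conv_lhs => rw [← sum_taylor_eq (Q k) b]
      rw [sum_over_range' _ (by simp) l (by rw [natDegree_taylor, hQd]; exact k.2),
        Finset.sum_range]
    simp only [hN, hUd, Matrix.of_apply, hankM]
    rw [e1, ← TT_pow]
    conv_lhs => rw [e2]
    rw [Finset.mul_sum, TT_sum, eval_finsetSum]
    refine Finset.sum_congr rfl fun j _ => ?_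
    rw [show (X - C b) ^ (i : ℕ) * (C ((taylor b (Q k)).coeff j) * (X - C b) ^ (j : ℕ)) =
      C ((taylor b (Q k)).coeff j) * ((X - C b) ^ ((i : ℕ) + (j : ℕ)) * 1) by ring, TT_C_mul,
      eval_mul, eval_C, mul_comm]
  have hdet : N.det = (hankM x b l 1).det := by rw [hNU, Matrix.det_mul, hU, mul_one]
  rw [← hdet, Matrix.det_of_isLowerTriangular N]
  · have : ∀ i : Fin l, N i i = (-1) ^ (i : ℕ) * ((1/2) ^ (i : ℕ) * (i : ℕ).factorial) := by
      intro i
      have h := opA_pow_eval (-(1/2)) b x i 1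
      rw [mul_one] at h
      simp only [hN, Matrix.of_apply]
      rw [h, neg_pow]
      simp
      ring
    simp only [this]
    rw [Finset.prod_mul_distrib, Finset.prod_pow_eq_pow_sum, ← mul_assoc,
      ← Finset.sum_range (fun i => i), Finset.sum_range_id, ← mul_pow]
    have : 0 < ∏ i : Fin l, ((1/2 : ℝ) ^ (i : ℕ) * (i : ℕ).factorial) :=
      Finset.prod_pos fun i _ => by positivity
    simpa using this
  · intro i k hik
    have hik : (i : ℕ) < k := by simpa using hik
    simp only [hN, Matrix.of_apply]
    rw [show (X - C x) ^ (k : ℕ) = (X - C x) ^ (i : ℕ) * (X - C x) ^ ((k : ℕ) - i) by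
      rw [← pow_add]; congr 1; omega, opA_pow_eval]
    have : (k : ℕ) - i ≠ 0 := by omega
    simp [this]

lemma hankM_pos (x b : ℝ) (l : ℕ) (hl : Even l) (s : Multiset ℝ) :
    0 < (-1 : ℝ) ^ (l * (l - 1) / 2) * (hankM x b l (s.map fun a => X - C a).prod).det := by
  induction s using Multiset.induction_on with
  | empty => simpa using hankM_base x b l
  | cons a s ih =>
    rw [Multiset.map_cons, Multiset.prod_cons]
    refine hankM_step x b a _ l hl _ ?_ ?_ ih
    · exact (monic_multiset_prod_of_monic _ _ fun a _ => monic_X_sub_C a).ne_zero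
    · refine Splits.multisetProd ?_
      intro p hp
      obtain ⟨a, _, rfl⟩ := Multiset.mem_map.1 hp
      exact Splits.X_sub_C a

lemma hermite_eq {r : ℕ} (c : Fin r → ℝ) (hc : Function.Injective c) (n : Fin r → ℕ)
    (P : ℝ[X]) (hP : IsMultipleHermite c n P) :
    P = TT (-(1/2)) (∏ i, (X - C (c i / 2)) ^ n i) := by
  obtain ⟨hm, hd, ho⟩ := hP
  have hdvd : ∀ i, (X - C (c i / 2)) ^ n i ∣ TT (1/2) P := by
    intro i
    apply opA_dvd (1/2) 0 (c i / 2) (by norm_num)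
    intro k hk
    have h1 := ho i k hk
    have h2 := integral_poly_gauss (c i / 2) _ ((X - C 0) ^ k * P) le_rfl
    rw [← TT_pow]
    have h3 : ∀ u : ℝ, u ^ k * P.eval u * Real.exp (-u ^ 2 + c i * u) =
       Real.exp ((c i / 2) ^ 2) *
        (((X - C 0) ^ k * P).eval u * Real.exp (-(u - c i / 2) ^ 2)) := by
      intro u
      rw [show -u ^ 2 + c i * u = (c i / 2) ^ 2 + -(u - c i / 2) ^ 2 by ring, Real.exp_add]
      simp
      ring
    simp_rw [h3] at h1
    rw [integral_const_mul, h2] at h1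
    have := Real.exp_pos ((c i / 2) ^ 2)
    have h5 : 0 < √Real.pi := Real.sqrt_pos.2 Real.pi_pos
    rcases mul_eq_zero.1 h1 with h | h
    · exact absurd h this.ne'
    · exact (mul_eq_zero.1 h).resolve_left h5.ne'
  have hprod : (∏ i, (X - C (c i / 2)) ^ n i) ∣ TT (1/2) P := by
    apply Finset.prod_dvd_of_coprime
    · intro i _ k _ hik
      apply IsCoprime.pow
      apply isCoprime_X_sub_C_of_isUnit_sub
      rw [isUnit_iff_ne_zero]
      intro h
      exact hik (hc (by linarith))
    · intro i _; exact hdvd i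
  have hWm : (∏ i, (X - C (c i / 2)) ^ n i).Monic :=
    monic_prod_of_monic _ _ fun i _ => (monic_X_sub_C _).pow _
  have heq : TT (1/2) P = ∏ i, (X - C (c i / 2)) ^ n i := by
    refine eq_of_monic_of_dvd_of_natDegree_le hWm (TT_monic _ _ hm) hprod ?_
    rw [TT_natDegree, hd, natDegree_prod_of_monic _ _ fun i _ => (monic_X_sub_C _).pow _]
    simp
  have := TT_inv (-(1/2)) P
  rw [neg_neg, heq] at this
  exact this.symm

/-- for `l` even and positive, the Hankel determinant of multiple Hermite
polynomials satisfies `(−1)^(l(l−1)/2) det (H_{n+(i+k)e_j}(x))_{i,k<l} > 0` for all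
real `x`. -/
theorem multipleHermite_hankel_sign {r : ℕ} (hr : 1 ≤ r)
    (c : Fin r → ℝ) (hc : Function.Injective c)
    (H : (Fin r → ℕ) → Polynomial ℝ) (hH : ∀ n, IsMultipleHermite c n (H n))
    (n : Fin r → ℕ) (j : Fin r) (l : ℕ) (hl : 1 ≤ l) (hleven : Even l) (x : ℝ) :
    0 < (-1 : ℝ) ^ (l * (l - 1) / 2) *
        Matrix.det (Matrix.of fun i k : Fin l =>
          (H (n + ((i : ℕ) + (k : ℕ)) • unitMI j)).eval x) := by
  have hpos := hankM_pos x (c j / 2) l hleven (∑ i, n i • {c i / 2})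
  convert hpos using 3
  ext i k
  simp only [hankM, Matrix.of_apply]
  rw [hermite_eq c hc _ _ (hH _)]
  congr 2
  have h1 : (Multiset.map (fun a => X - C a) (∑ i, n i • ({c i / 2} : Multiset ℝ))).prod =
      ∏ i, (X - C (c i / 2)) ^ n i := by
    have : ∀ t : Finset (Fin r),
        (Multiset.map (fun a => X - C a) (∑ i ∈ t, n i • ({c i / 2} : Multiset ℝ))).prod =
        ∏ i ∈ t, (X - C (c i / 2)) ^ n i := by
      intro t
      induction t using Finset.induction_on with
      | empty => simp
      | insert a t ha ih =>
        rw [Finset.sum_insert ha, Finset.prod_insert ha, Multiset.map_add, Multiset.prod_add, ih]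
        simp [Multiset.map_nsmul, Multiset.prod_nsmul]
    exact this _
  rw [h1]
  simp only [Pi.add_apply, Pi.smul_apply, unitMI, smul_eq_mul, pow_add, Finset.prod_mul_distrib]
  simp [pow_add]
  ring
end

section
/- The multiple Laguerre polynomials of the first kind satisfy the two-parameter Turán inequality L_{n⃗+e⃗_k}^{α⃗}(x) · L_{n⃗+e⃗_j}^{α⃗−e⃗_j}(x) − L_{n⃗}^{α⃗}(x) · L_{n⃗+e⃗_j+e⃗_k}^{α⃗−e⃗_j}(x) > 0 for all x > 0, for every multi-index n⃗ ∈ ℕ^r, all j, k ∈ {1, …, r}, provided α_i > 0 for every i = 1, …, r. -/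
open MeasureTheory Polynomial Finset

/-- `P` is the multiple Laguerre polynomial of the first kind for the parameters `α`
and the multi-index `n`: it is monic of degree `|n|` and satisfies
`∫_0^∞ x^k P(x) x^(α j) exp(-x) dx = 0` for all `k < n j` and all `j`. -/
def IsMultipleLaguerreI {r : ℕ} (α : Fin r → ℝ) (n : Fin r → ℕ)
    (P : Polynomial ℝ) : Prop :=
  P.Monic ∧ P.natDegree = ∑ i, n i ∧
    ∀ j : Fin r, ∀ k < n j,
      ∫ x in Set.Ioi (0 : ℝ), x ^ k * P.eval x * (x ^ (α j) * Real.exp (-x)) = 0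

/-- The `j`-th standard unit vector `e⃗_j` in `ℝ^r`. -/
def unitR {r : ℕ} (j : Fin r) : Fin r → ℝ := fun i => if i = j then 1 else 0


noncomputable def mlEll (b : ℝ) : ℝ[X] →ₗ[ℝ] ℝ :=
  Polynomial.lsum (fun k => (Real.Gamma (b + k + 1)) • LinearMap.id)

lemma mlEll_monomial (b : ℝ) (k : ℕ) (a : ℝ) :
    mlEll b (monomial k a) = Real.Gamma (b + k + 1) * a := by
  simp [mlEll, Polynomial.lsum_apply, Polynomial.sum_monomial_index]

lemma mlEll_integral (b : ℝ) (hb : -1 < b) (k : ℕ) (P : ℝ[X]) :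
    ∫ x in Set.Ioi (0 : ℝ), x ^ k * P.eval x * (x ^ b * Real.exp (-x)) = mlEll (b + k) P := by
  have h1 : mlEll (b + k) P = ∑ i ∈ range (P.natDegree + 1),
      Real.Gamma (b + k + i + 1) * P.coeff i := by
    conv_lhs => rw [P.as_sum_range]
    rw [map_sum]
    exact Finset.sum_congr rfl fun i _ => mlEll_monomial _ _ _
  have h2 : ∫ x in Set.Ioi (0 : ℝ), x ^ k * P.eval x * (x ^ b * Real.exp (-x)) =
      ∫ x in Set.Ioi (0 : ℝ), ∑ i ∈ range (P.natDegree + 1),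
        P.coeff i * (Real.exp (-x) * x ^ ((b + k + i + 1) - 1)) := by
    refine setIntegral_congr_fun measurableSet_Ioi fun x hx => ?_
    have hx : 0 < x := hx
    rw [eval_eq_sum_range, Finset.mul_sum, Finset.sum_mul]
    refine Finset.sum_congr rfl fun i _ => ?_
    rw [add_sub_cancel_right, Real.rpow_add_natCast hx.ne', Real.rpow_add_natCast hx.ne']
    ring
  rw [h1, h2, integral_finsetSum]
  · refine Finset.sum_congr rfl fun i _ => ?_
    rw [integral_const_mul, Real.Gamma_eq_integral, mul_comm]
    have : (0:ℝ) ≤ k := k.cast_nonneg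
    have : (0:ℝ) ≤ i := i.cast_nonneg
    linarith
  · intro i _
    refine Integrable.const_mul ?_ _
    refine Real.GammaIntegral_convergent ?_
    have : (0:ℝ) ≤ k := k.cast_nonneg
    have : (0:ℝ) ≤ i := i.cast_nonneg
    linarith

noncomputable def mlD (b : ℝ) : ℝ[X] →ₗ[ℝ] ℝ[X] where
  toFun Q := (X - C (b + 1)) * Q - X * derivative Q
  map_add' := by intro p q; simp; ring
  map_smul' := by intro c p; simp [smul_eq_C_mul]; ring

lemma mlD_apply (b : ℝ) (Q : ℝ[X]) : mlD b Q = (X - C (b + 1)) * Q - X * derivative Q := rfl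

lemma mlD_monomial (b : ℝ) (k : ℕ) (a : ℝ) :
    mlD b (monomial k a) = monomial (k+1) a - monomial k ((b + 1 + k) * a) := by
  rw [mlD_apply, derivative_monomial, sub_mul, X_mul_monomial, X_mul_monomial, C_mul_monomial,
    sub_sub]
  congr 1
  rcases k with _ | k
  · simp
  · simp only [Nat.add_sub_cancel, ← map_add]
    congr 1
    ring

lemma mlEll_mlD (b c : ℝ) (hb : -1 < b) (Q : ℝ[X]) :
    mlEll b (mlD c Q) = (b - c) * mlEll b Q := by
  induction Q using Polynomial.induction_on' with
  | add p q hp hq => rw [map_add, map_add, hp, hq, map_add]; ring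
  | monomial k a =>
    rw [mlD_monomial, map_sub, mlEll_monomial, mlEll_monomial, mlEll_monomial]
    have hk : (0:ℝ) ≤ k := k.cast_nonneg
    have : b + ((k + 1 : ℕ) : ℝ) + 1 = (b + k + 1) + 1 := by push_cast; ring
    rw [this, Real.Gamma_add_one (by linarith)]
    ring

lemma mlD_div (b : ℝ) (Q : ℝ[X]) : ∃ R : ℝ[X], ∃ c : ℝ, Q = mlD b R + C c := by
  induction Q using Polynomial.induction_on' with
  | add p q hp hq =>
    obtain ⟨R, c, h⟩ := hp
    obtain ⟨R', c', h'⟩ := hq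
    exact ⟨R + R', c + c', by rw [h, h', map_add, C_add]; ring⟩
  | monomial k a =>
    induction k generalizing a with
    | zero => exact ⟨0, a, by simp⟩
    | succ k ih =>
      obtain ⟨R, c, h⟩ := ih ((b + 1 + k) * a)
      refine ⟨monomial k a + R, c, ?_⟩
      rw [map_add, mlD_monomial, add_assoc, ← h]
      ring

lemma mlD_surj (b : ℝ) (hb : -1 < b) (Q : ℝ[X]) (h : mlEll b Q = 0) :
    ∃ R : ℝ[X], Q = mlD b R := by
  obtain ⟨R, c, rfl⟩ := mlD_div b Q
  rw [map_add, mlEll_mlD _ _ hb, sub_self, zero_mul, zero_add, ← monomial_zero_left,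
    mlEll_monomial] at h
  have := Real.Gamma_pos_of_pos (s := b + (0:ℕ) + 1) (by push_cast; linarith)
  have hc : c = 0 := by
    rcases mul_eq_zero.1 h with h | h
    · exact absurd h this.ne'
    · exact h
  exact ⟨R, by simp [hc]⟩

/-- `f` takes values of alternating sign at `m + 1` increasing positive points. -/
def MlAlt (m : ℕ) (f : ℝ → ℝ) : Prop :=
  ∃ t : ℕ → ℝ, ∃ e : ℝ, (∀ i ≤ m, 0 < t i ∧ 0 < (-1) ^ i * e * f (t i)) ∧
    ∀ i < m, t i < t (i + 1)

lemma mlAlt_deriv (m : ℕ) (f f' : ℝ → ℝ) (hc : ContinuousOn f (Set.Ici 0))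
    (hd : ∀ x > 0, HasDerivAt f (f' x) x) (h0 : f 0 = 0)
    (hinf : Filter.Tendsto f Filter.atTop (nhds 0)) (h : MlAlt m f) : MlAlt (m + 1) f' := by
  obtain ⟨t, e, h1, h2⟩ := h
  have mvt : ∀ a b : ℝ, 0 ≤ a → a < b → ∀ c : ℝ, c * f a < c * f b →
      ∃ s, a < s ∧ s < b ∧ 0 < c * f' s := by
    intro a b ha hab c hcc
    obtain ⟨s, hs, hs'⟩ := exists_hasDerivAt_eq_slope f f' hab
      (hc.mono fun y hy => ha.trans hy.1) (fun y hy => hd y (ha.trans_lt hy.1))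
    refine ⟨s, hs.1, hs.2, ?_⟩
    rw [hs', ← mul_div_assoc]
    apply div_pos <;> linarith
  have key : ∀ i, ∃ s, i ≤ m + 1 → 0 < s ∧ (i ≤ m → s < t i) ∧ (1 ≤ i → t (i - 1) < s) ∧
      0 < (-1) ^ i * e * f' s := by
    intro i
    rcases i with _ | i
    · obtain ⟨s, a1, a2, a3⟩ := mvt 0 (t 0) le_rfl (h1 0 (by omega)).1 ((-1) ^ 0 * e)
        (by rw [h0, mul_zero]; exact (h1 0 (by omega)).2)
      exact ⟨s, fun _ => ⟨a1, fun _ => a2, by omega, a3⟩⟩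
    · by_cases hi : i + 1 ≤ m
      · have p1 := h1 i (by omega)
        have p2 := h1 (i+1) hi
        obtain ⟨s, a1, a2, a3⟩ := mvt (t i) (t (i+1)) p1.1.le (h2 i (by omega))
          ((-1) ^ (i+1) * e) (by
            have : (-1:ℝ) ^ (i+1) * e * f (t i) = - ((-1) ^ i * e * f (t i)) := by
              rw [pow_succ]; ring
            linarith [p1.2, p2.2])
        exact ⟨s, fun _ => ⟨p1.1.trans a1, fun _ => a2, fun _ => a1, a3⟩⟩
      · by_cases hi' : i = m
        · subst hi'
          have p1 := h1 i le_rfl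
          have ht : Filter.Tendsto (fun y => (-1) ^ i * e * f y) Filter.atTop (nhds 0) := by
            simpa using hinf.const_mul ((-1) ^ i * e)
          obtain ⟨T, hT, hT'⟩ := ((ht.eventually_lt_const p1.2).and
            (Filter.eventually_gt_atTop (t i))).exists
          obtain ⟨s, a1, a2, a3⟩ := mvt (t i) T p1.1.le hT' ((-1) ^ (i+1) * e) (by
            rw [pow_succ]; linarith)
          exact ⟨s, fun _ => ⟨p1.1.trans a1, fun h => absurd h hi, fun _ => a1, a3⟩⟩
        · exact ⟨0, fun h => by omega⟩
  choose s hs using key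
  refine ⟨s, e, fun i hi => ⟨(hs i hi).1, (hs i hi).2.2.2⟩, fun i hi => ?_⟩
  exact ((hs i (by omega)).2.1 (by omega)).trans ((hs (i+1) (by omega)).2.2.1 (by omega))

lemma mlAlt_congr (m : ℕ) (f g u : ℝ → ℝ) (hu : ∀ x > 0, 0 < u x)
    (hfg : ∀ x > 0, f x ≠ 0 → f x = u x * g x) (h : MlAlt m f) : MlAlt m g := by
  obtain ⟨t, e, h1, h2⟩ := h
  refine ⟨t, e, fun i hi => ⟨(h1 i hi).1, ?_⟩, h2⟩
  obtain ⟨p, q⟩ := h1 i hi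
  rw [hfg _ p (by intro h; simp [h] at q)] at q
  have := hu _ p
  have q' : 0 < u (t i) * ((-1) ^ i * e * g (t i)) := by linarith
  exact (pos_iff_pos_of_mul_pos q').1 this

lemma mlAlt_neg (m : ℕ) (f : ℝ → ℝ) (h : MlAlt m f) : MlAlt m (fun x => - f x) := by
  obtain ⟨t, e, h1, h2⟩ := h
  refine ⟨t, -e, fun i hi => ⟨(h1 i hi).1, ?_⟩, h2⟩
  have := (h1 i hi).2
  linarith

lemma mlAlt_mlD (m : ℕ) (b : ℝ) (hb : -1 < b) (Q : ℝ[X]) (h : MlAlt m (fun x => Q.eval x)) :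
    MlAlt (m + 1) (fun x => (mlD b Q).eval x) := by
  have hexp : ∀ (a : ℝ), Filter.Tendsto (fun x : ℝ => x ^ a * Real.exp (-x) * Q.eval x)
      Filter.atTop (nhds 0) := by
    intro a
    have h1 : Filter.Tendsto (fun x : ℝ => ∑ i ∈ range (Q.natDegree + 1),
        Q.coeff i * (x ^ (a + i) * Real.exp (- 1 * x))) Filter.atTop (nhds 0) := by
      rw [show (0:ℝ) = ∑ i ∈ range (Q.natDegree + 1), Q.coeff i * 0 by simp]
      exact tendsto_finsetSum _ fun i _ =>
        (tendsto_rpow_mul_exp_neg_mul_atTop_nhds_zero _ 1 one_pos).const_mul _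
    refine h1.congr' ?_
    filter_upwards [Filter.eventually_gt_atTop 0] with x hx
    rw [eval_eq_sum_range, Finset.mul_sum]
    refine Finset.sum_congr rfl fun i _ => ?_
    rw [Real.rpow_add_natCast hx.ne', neg_one_mul]
    ring
  have hA : MlAlt m (fun x => x ^ (b + 1) * Real.exp (-x) * Q.eval x) := by
    refine mlAlt_congr m _ _ (fun x => x ^ (-(b + 1)) * Real.exp x) (fun x hx => by positivity)
      (fun x hx _ => ?_) h
    rw [Real.rpow_neg hx.le, Real.exp_neg]
    have : (0:ℝ) < x ^ (b + 1) := by positivity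
    field_simp
  have hB := mlAlt_deriv m _ (fun x => -(x ^ b * Real.exp (-x) * (mlD b Q).eval x))
    ?_ ?_ ?_ (hexp _) hA
  · have := mlAlt_neg _ _ hB
    refine mlAlt_congr _ _ _ (fun x => x ^ b * Real.exp (-x)) (fun x hx => by positivity)
      (fun x hx _ => ?_) this
    simp
  · refine ContinuousOn.mul (ContinuousOn.mul ?_ (by fun_prop)) (by fun_prop)
    exact continuousOn_id.rpow_const fun x _ => Or.inr (by linarith)
  · intro x hx
    have d1 := (Real.hasDerivAt_rpow_const (x := x) (p := b + 1) (Or.inl (ne_of_gt hx)))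
    have d2 : HasDerivAt (fun x : ℝ => Real.exp (-x)) (Real.exp (-x) * (-1)) x :=
      (hasDerivAt_neg x).exp
    have d3 := (d1.mul d2).mul (Q.hasDerivAt x)
    refine d3.congr_deriv ?_
    simp only [mlD_apply, eval_sub, eval_mul, eval_X, eval_C, add_sub_cancel_right, Pi.mul_apply]
    rw [Real.rpow_add_one (ne_of_gt hx)]
    ring
  · rw [Real.zero_rpow (by linarith)]; simp

lemma mlAlt_main (S : Finset ℝ) (hS : ∀ b ∈ S, -1 < b) (Q : ℝ[X]) (hQ : Q ≠ 0)
    (h : ∀ b ∈ S, mlEll b Q = 0) : MlAlt S.card (fun x => Q.eval x) := by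
  induction S using Finset.induction_on generalizing Q with
  | empty =>
    obtain ⟨x, hx, hx'⟩ : ∃ x : ℝ, 0 < x ∧ Q.eval x ≠ 0 := by
      by_contra! hcon
      refine hQ (Polynomial.eq_zero_of_infinite_isRoot Q ?_)
      exact (Set.Ioi_infinite (0:ℝ)).mono fun x hx => hcon x hx
    refine ⟨fun _ => x, Q.eval x, fun i hi => ⟨hx, ?_⟩, fun i hi => by simp at hi⟩
    have : i = 0 := by simpa using hi
    subst this
    simp only [pow_zero, one_mul]
    exact mul_self_pos.2 hx'
  | insert b S hbS ih =>
    obtain ⟨R, rfl⟩ := mlD_surj b (hS b (by simp)) Q (h b (by simp))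
    rw [Finset.card_insert_of_notMem hbS]
    refine mlAlt_mlD _ b (hS b (by simp)) R (ih (fun c hc => hS c (by simp [hc])) R ?_ ?_)
    · rintro rfl; simp at hQ
    · intro c hc
      have := h c (by simp [hc])
      rw [mlEll_mlD _ _ (hS c (by simp [hc]))] at this
      rcases mul_eq_zero.1 this with h' | h'
      · exact absurd (by linarith : c = b) (by rintro rfl; exact hbS hc)
      · exact h'

lemma mlAlt_natDegree (m : ℕ) (Q : ℝ[X]) (h : MlAlt m (fun x => Q.eval x)) :
    m ≤ Q.natDegree := by
  obtain ⟨t, e, h1, h2⟩ := h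
  have hQ : Q ≠ 0 := by
    rintro rfl
    have := (h1 0 (by omega)).2
    simp at this
  have key : ∀ i, ∃ z, i < m → t i < z ∧ z < t (i+1) ∧ Q.eval z = 0 := by
    intro i
    by_cases hi : i < m
    · have p1 := (h1 i (by omega)).2
      have p2 := (h1 (i+1) (by omega)).2
      have hc : ContinuousOn (fun x => (-1) ^ i * e * Q.eval x) (Set.Icc (t i) (t (i+1))) := by
        fun_prop
      obtain ⟨z, hz, hz'⟩ := intermediate_value_Ioo' (h2 i hi).le hc (show (0:ℝ) ∈ _ from
        ⟨by rw [pow_succ] at p2; simp only at p2 ⊢; linarith, p1⟩)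
      refine ⟨z, fun _ => ⟨hz.1, hz.2, ?_⟩⟩
      rcases mul_eq_zero.1 hz' with h | h
      · rw [h] at p1; simp at p1
      · exact h
    · exact ⟨0, fun h => absurd h hi⟩
  choose z hz using key
  have ht : ∀ i j, i ≤ j → j ≤ m → t i ≤ t j := by
    intro i j hij
    induction j, hij using Nat.le_induction with
    | base => intro _; exact le_rfl
    | succ j hj ih => intro hm; exact (ih (by omega)).trans (h2 j (by omega)).le
  have hlt : ∀ i j, i < j → j < m → z i < z j := fun i j hij hj =>
    ((hz i (by omega)).2.1.trans_le (ht (i+1) j hij hj.le)).trans (hz j hj).1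
  have hcard : ((range m).image z).card = m := by
    rw [Finset.card_image_of_injOn, card_range]
    intro i hi j hj hij
    have hi : i < m := by simpa using hi
    have hj : j < m := by simpa using hj
    rcases lt_trichotomy i j with h | h | h
    · exact absurd hij (hlt i j h hj).ne
    · exact h
    · exact absurd hij (hlt j i h hi).ne'
  calc m = ((range m).image z).card := hcard.symm
    _ ≤ Q.natDegree := by
      refine Polynomial.card_le_degree_of_subset_roots ?_
      intro y hy
      simp only [Finset.image_val, Multiset.mem_dedup, Multiset.mem_map, range_val,
        Multiset.mem_range] at hy
      obtain ⟨i, hi, rfl⟩ := hy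
      rw [mem_roots hQ]
      exact (hz i hi).2.2

/-- exponents attached to a multi-index -/
noncomputable def mlExp {r : ℕ} (α : Fin r → ℝ) (n : Fin r → ℕ) : Finset ℝ :=
  ((univ : Finset (Fin r)).sigma fun i => range (n i)).image fun p => α p.1 + (p.2 : ℝ)

lemma mlExp_card {r : ℕ} (α : Fin r → ℝ) (n : Fin r → ℕ)
    (hαZ : ∀ i j : Fin r, i ≠ j → ∀ z : ℤ, α i - α j ≠ (z : ℝ)) :
    (mlExp α n).card = ∑ i, n i := by
  rw [mlExp, Finset.card_image_of_injOn]
  · simp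
  · rintro ⟨i, a⟩ _ ⟨j, b⟩ _ h
    simp only at h
    by_cases hij : i = j
    · subst hij
      have : a = b := by exact_mod_cast add_left_cancel h
      rw [this]
    · exact absurd (by push_cast; linarith) (hαZ i j hij ((b:ℤ) - (a:ℤ)))

lemma mlExp_gt {r : ℕ} (α : Fin r → ℝ) (n : Fin r → ℕ) (hα : ∀ i, -1 < α i) :
    ∀ b ∈ mlExp α n, -1 < b := by
  intro b hb
  simp only [mlExp, Finset.mem_image] at hb
  obtain ⟨p, _, rfl⟩ := hb
  have : (0:ℝ) ≤ p.2 := Nat.cast_nonneg _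
  linarith [hα p.1]

lemma mlExp_ell {r : ℕ} (α : Fin r → ℝ) (n : Fin r → ℕ) (hα : ∀ i, -1 < α i) (P : ℝ[X]) :
    (∀ j : Fin r, ∀ k < n j,
      ∫ x in Set.Ioi (0 : ℝ), x ^ k * P.eval x * (x ^ (α j) * Real.exp (-x)) = 0) ↔
    ∀ b ∈ mlExp α n, mlEll b P = 0 := by
  constructor
  · intro h b hb
    simp only [mlExp, Finset.mem_image] at hb
    obtain ⟨⟨i, k⟩, hp, rfl⟩ := hb
    have := h i k (by simpa using hp)
    rwa [mlEll_integral _ (hα i)] at this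
  · intro h i k hk
    rw [mlEll_integral _ (hα i)]
    exact h _ (Finset.mem_image.2 ⟨⟨i, k⟩, by simpa using hk, rfl⟩)

lemma ml_unique {r : ℕ} (α : Fin r → ℝ) (n : Fin r → ℕ) (hα : ∀ i, -1 < α i)
    (hαZ : ∀ i j : Fin r, i ≠ j → ∀ z : ℤ, α i - α j ≠ (z : ℝ)) (P Q : ℝ[X])
    (hP : P.Monic) (hPd : P.natDegree = ∑ i, n i) (hQ : Q.Monic) (hQd : Q.natDegree = ∑ i, n i)
    (hP' : ∀ b ∈ mlExp α n, mlEll b P = 0) (hQ' : ∀ b ∈ mlExp α n, mlEll b Q = 0) : P = Q := by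
  by_contra hne
  have hsub : P - Q ≠ 0 := sub_ne_zero.2 hne
  have h1 := mlAlt_natDegree _ _ (mlAlt_main (mlExp α n) (mlExp_gt α n hα) (P - Q) hsub
    (fun b hb => by rw [map_sub, hP' b hb, hQ' b hb, sub_zero]))
  rw [mlExp_card α n hαZ] at h1
  have h2 : (P - Q).degree < P.degree := degree_sub_lt_left
    (by rw [degree_eq_natDegree hP.ne_zero, degree_eq_natDegree hQ.ne_zero, hPd, hQd])
    hP.ne_zero (by rw [hP.leadingCoeff, hQ.leadingCoeff])
  have := natDegree_lt_natDegree hsub h2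
  omega

lemma mlD_monic (b : ℝ) (P : ℝ[X]) (hP : P.Monic) :
    (mlD b P).Monic ∧ (mlD b P).natDegree = P.natDegree + 1 := by
  have h1 : (mlD b P).coeff (P.natDegree + 1) = 1 := by
    rw [mlD_apply, sub_mul, coeff_sub, coeff_sub, coeff_X_mul, coeff_X_mul, coeff_C_mul,
      coeff_derivative, coeff_eq_zero_of_natDegree_lt (Nat.lt_succ_self P.natDegree)]
    simp [hP.coeff_natDegree]
  have h2 : (mlD b P).natDegree ≤ P.natDegree + 1 := by
    rw [natDegree_le_iff_coeff_eq_zero]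
    intro N hN
    obtain ⟨M, rfl⟩ : ∃ M, N = M + 1 := ⟨N - 1, by omega⟩
    rw [mlD_apply, sub_mul, coeff_sub, coeff_sub, coeff_X_mul, coeff_X_mul, coeff_C_mul,
      coeff_derivative, coeff_eq_zero_of_natDegree_lt (by omega : P.natDegree < M),
      coeff_eq_zero_of_natDegree_lt (by omega : P.natDegree < M + 1)]
    simp
  refine ⟨monic_of_natDegree_le_of_coeff_eq_one _ h2 h1, le_antisymm h2 ?_⟩
  exact le_natDegree_of_ne_zero (by rw [h1]; exact one_ne_zero)

lemma ml_sum_unit {r : ℕ} (n : Fin r → ℕ) (j : Fin r) :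
    ∑ i, (n + unitMI j) i = ∑ i, n i + 1 := by
  simp [unitMI, Finset.sum_add_distrib]

lemma ml_raise {r : ℕ} (α : Fin r → ℝ) (hα : ∀ i, 0 < α i)
    (hαZ : ∀ i j : Fin r, i ≠ j → ∀ z : ℤ, α i - α j ≠ (z : ℝ)) (j : Fin r)
    (n : Fin r → ℕ) (P Q : ℝ[X]) (hP : IsMultipleLaguerreI α n P)
    (hQ : IsMultipleLaguerreI (α - unitR j) (n + unitMI j) Q) :
    Q = mlD (α j - 1) P := by
  obtain ⟨p1, p2, p3⟩ := hP
  obtain ⟨q1, q2, q3⟩ := hQ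
  have hα1 : ∀ i, -1 < α i := fun i => by linarith [hα i]
  have hα2 : ∀ i, -1 < (α - unitR j) i := fun i => by
    simp only [Pi.sub_apply, unitR]
    split_ifs <;> linarith [hα i]
  rw [mlExp_ell _ _ hα1] at p3
  rw [mlExp_ell _ _ hα2] at q3
  obtain ⟨d1, d2⟩ := mlD_monic (α j - 1) P p1
  refine ml_unique (α - unitR j) (n + unitMI j) hα2 ?_ Q _ q1 q2 d1 ?_ q3 ?_
  · intro i l hil z hz
    simp only [Pi.sub_apply, unitR] at hz
    split_ifs at hz with h1 h2 h2
    · exact hil (h1.trans h2.symm)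
    · exact hαZ i l hil (z + 1) (by push_cast; linarith)
    · exact hαZ i l hil (z - 1) (by push_cast; linarith)
    · exact hαZ i l hil z (by linarith)
  · rw [d2, p2, ml_sum_unit]
  · intro b hb
    rw [mlEll_mlD _ _ (mlExp_gt _ _ hα2 b hb)]
    simp only [mlExp, Finset.mem_image] at hb
    obtain ⟨⟨i, k⟩, hp, rfl⟩ := hb
    simp only [Finset.mem_sigma, Finset.mem_univ, true_and, Finset.mem_range, Pi.add_apply,
      unitMI] at hp
    simp only [Pi.sub_apply, unitR]
    by_cases hij : i = j
    · subst hij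
      simp only [if_true] at hp ⊢
      rcases k with _ | k
      · simp
      · rw [p3 _ (Finset.mem_image.2 ⟨⟨i, k⟩, by simp; omega, by push_cast; ring⟩), mul_zero]
    · simp only [hij, if_false, add_zero, sub_zero] at hp ⊢
      rw [p3 _ (Finset.mem_image.2 ⟨⟨i, k⟩, by simpa using hp, rfl⟩), mul_zero]

lemma ml_double (S : Finset ℝ) (hS : ∀ b ∈ S, -1 < b) (F : ℝ[X]) (hF : F ≠ 0)
    (h : ∀ b ∈ S, mlEll b F = 0) (hd : F.natDegree ≤ S.card + 1) (x : ℝ)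
    (h0 : F.eval x = 0) (h1 : (derivative F).eval x = 0) : False := by
  have hm : 2 ≤ F.rootMultiplicity x :=
    (one_lt_rootMultiplicity_iff_isRoot hF).2 ⟨h0, h1⟩
  obtain ⟨R, hR⟩ := (le_rootMultiplicity_iff hF).1 hm
  have hR0 : R ≠ 0 := by rintro rfl; simp at hR; exact hF hR
  have hdeg : F.natDegree = 2 + R.natDegree := by
    rw [hR, ((monic_X_sub_C x).pow 2).natDegree_mul' hR0, natDegree_pow, natDegree_X_sub_C]
  have hA := mlAlt_main S hS F hF h
  obtain ⟨t, e, a1, a2⟩ := hA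
  have hA' : MlAlt S.card (fun x => R.eval x) := by
    refine ⟨t, e, fun i hi => ⟨(a1 i hi).1, ?_⟩, a2⟩
    have := (a1 i hi).2
    simp only [hR, eval_mul, eval_pow, eval_sub, eval_X, eval_C] at this
    have h' : 0 < (t i - x) ^ 2 * ((-1) ^ i * e * R.eval (t i)) := by linarith
    exact pos_of_mul_pos_right h' (sq_nonneg _)
  have := mlAlt_natDegree _ _ hA'
  omega

lemma ml_monic_pos (W : ℝ[X]) (hW : W.Monic) (h : ∀ x > 0, W.eval x ≠ 0) (x : ℝ) (hx : 0 < x) :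
    0 < W.eval x := by
  by_contra hcon
  have hlt : W.eval x < 0 := lt_of_le_of_ne (not_lt.1 hcon) (h x hx)
  by_cases hd : W.natDegree = 0
  · rw [hW.natDegree_eq_zero.1 hd] at hlt
    simp at hlt
    linarith
  · have ht := Polynomial.tendsto_atTop_of_leadingCoeff_nonneg W
      (natDegree_pos_iff_degree_pos.1 (Nat.pos_of_ne_zero hd))
      (by rw [hW.leadingCoeff]; exact zero_le_one)
    obtain ⟨y, hy, hxy⟩ := ((ht.eventually_gt_atTop 0).and (Filter.eventually_gt_atTop x)).exists
    obtain ⟨z, hz, hz'⟩ := intermediate_value_Ioo hxy.le (W.continuous.continuousOn)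
      (show (0:ℝ) ∈ _ from ⟨hlt, hy⟩)
    exact h z (hx.trans hz.1) hz'

lemma ml_wronskian_monic (P Q : ℝ[X]) (hP : P.Monic) (hQ : Q.Monic)
    (hd : Q.natDegree = P.natDegree + 1) : (P * derivative Q - Q * derivative P).Monic := by
  have hQ' : (derivative Q).natDegree ≤ P.natDegree := by
    have := natDegree_derivative_le Q; omega
  have hQc : (derivative Q).coeff P.natDegree = P.natDegree + 1 := by
    rw [coeff_derivative, ← hd, hQ.coeff_natDegree, one_mul]
  by_cases h0 : P.natDegree = 0
  · have hP1 := hP.natDegree_eq_zero.1 h0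
    rw [h0] at hQ' hQc
    subst hP1
    refine monic_of_natDegree_le_of_coeff_eq_one 0 ?_ ?_
    · simpa using hQ'
    · simpa using hQc
  · obtain ⟨N, hN⟩ := Nat.exists_eq_succ_of_ne_zero h0
    have hP' : (derivative P).natDegree ≤ N := by
      have := natDegree_derivative_le P; omega
    have hPc : (derivative P).coeff N = P.natDegree := by
      rw [coeff_derivative, ← Nat.succ_eq_add_one, ← hN, hP.coeff_natDegree, one_mul, hN]
      push_cast; ring
    have c1 : (P * derivative Q).coeff (P.natDegree + P.natDegree) = P.natDegree + 1 := by
      rw [coeff_mul_add_eq_of_natDegree_le le_rfl hQ', hQc, hP.coeff_natDegree, one_mul]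
    have c2 : (Q * derivative P).coeff (P.natDegree + P.natDegree) = P.natDegree := by
      rw [show P.natDegree + P.natDegree = Q.natDegree + N by omega,
        coeff_mul_add_eq_of_natDegree_le le_rfl hP', hPc, hQ.coeff_natDegree, one_mul]
    refine monic_of_natDegree_le_of_coeff_eq_one (P.natDegree + P.natDegree) ?_ ?_
    · refine (natDegree_sub_le _ _).trans (max_le ?_ ?_)
      · exact natDegree_mul_le.trans (by omega)
      · exact natDegree_mul_le.trans (by omega)
    · rw [coeff_sub, c1, c2]; ring

lemma ml_wronskian_ne (S : Finset ℝ) (hS : ∀ b ∈ S, -1 < b) (P Q : ℝ[X])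
    (hP : P.Monic) (hQ : Q.Monic) (hPd : P.natDegree = S.card)
    (hQd : Q.natDegree = S.card + 1) (hP' : ∀ b ∈ S, mlEll b P = 0)
    (hQ' : ∀ b ∈ S, mlEll b Q = 0) (x : ℝ) :
    (P * derivative Q - Q * derivative P).eval x ≠ 0 := by
  intro hW
  simp only [eval_sub, eval_mul] at hW
  have key : ∀ a b : ℝ, a * P.eval x + b * Q.eval x = 0 →
      a * (derivative P).eval x + b * (derivative Q).eval x = 0 → b = 0 ∧ a = 0 := by
    intro a b h0 h1
    by_contra hab
    refine ml_double S hS (C a * P + C b * Q) ?_ ?_ ?_ x ?_ ?_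
    · intro hz
      apply hab
      have hb : b = 0 := by
        have := congrArg (fun p => p.coeff Q.natDegree) hz
        simpa [coeff_C_mul, hQ.coeff_natDegree,
          coeff_eq_zero_of_natDegree_lt (by omega : P.natDegree < Q.natDegree)] using this
      refine ⟨hb, ?_⟩
      have := congrArg (fun p => p.coeff P.natDegree) hz
      simpa [coeff_C_mul, hP.coeff_natDegree, hb] using this
    · intro c hc
      rw [← smul_eq_C_mul, ← smul_eq_C_mul, map_add, map_smul, map_smul, hP' c hc, hQ' c hc]
      simp
    · refine (natDegree_add_le _ _).trans (max_le ?_ ?_)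
      · exact (natDegree_C_mul_le _ _).trans (by omega)
      · exact (natDegree_C_mul_le _ _).trans (by omega)
    · simpa using h0
    · simpa using h1
  obtain ⟨e1, e2⟩ := key (Q.eval x) (-(P.eval x)) (by ring) (by linarith)
  have e1' : P.eval x = 0 := by linarith
  obtain ⟨e3, e4⟩ := key ((derivative Q).eval x) (-((derivative P).eval x))
    (by rw [e1', e2]; ring) (by ring)
  have := key 1 0 (by rw [e1', e2]; ring) (by linarith)
  exact one_ne_zero this.2

/-- for `α i > 0`, the multiple Laguerre polynomials of the first kind
satisfy the two-parameter Turán inequality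
`L^{α}_{n+e_k}(x) L^{α−e_j}_{n+e_j}(x) − L^{α}_{n}(x) L^{α−e_j}_{n+e_j+e_k}(x) > 0`
for all `x > 0`. -/
theorem multipleLaguerreI_turan {r : ℕ} (hr : 1 ≤ r)
    (α : Fin r → ℝ) (hα : ∀ i, 0 < α i)
    (hαZ : ∀ i j : Fin r, i ≠ j → ∀ z : ℤ, α i - α j ≠ (z : ℝ))
    (j k : Fin r)
    (L L' : (Fin r → ℕ) → Polynomial ℝ)
    (hL : ∀ n, IsMultipleLaguerreI α n (L n))
    (hL' : ∀ n, IsMultipleLaguerreI (α - unitR j) n (L' n))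
    (n : Fin r → ℕ) (x : ℝ) (hx : 0 < x) :
    0 < (L (n + unitMI k)).eval x * (L' (n + unitMI j)).eval x -
        (L n).eval x * (L' (n + unitMI j + unitMI k)).eval x := by
  have hα1 : ∀ i, -1 < α i := fun i => by linarith [hα i]
  have r1 := ml_raise α hα hαZ j n _ _ (hL n) (hL' (n + unitMI j))
  have r2 := ml_raise α hα hαZ j (n + unitMI k) _ _ (hL (n + unitMI k))
    (hL' (n + unitMI k + unitMI j))
  rw [add_right_comm n (unitMI j) (unitMI k), r1, r2]
  obtain ⟨p1, p2, p3⟩ := hL n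
  obtain ⟨q1, q2, q3⟩ := hL (n + unitMI k)
  have q4 : ∀ b ∈ mlExp α n, mlEll b (L (n + unitMI k)) = 0 :=
    (mlExp_ell _ _ hα1 _).1 fun i l hl => q3 i l (by rw [Pi.add_apply]; omega)
  rw [mlExp_ell _ _ hα1] at p3
  rw [ml_sum_unit] at q2
  have hc := mlExp_card α n hαZ
  have hW := ml_monic_pos _ (ml_wronskian_monic _ _ p1 q1 (by rw [q2, p2]))
    (fun y _ => ml_wronskian_ne (mlExp α n) (mlExp_gt α n hα1) _ _ p1 q1 (by rw [p2, hc])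
      (by rw [q2, hc]) p3 q4 y) x hx
  simp only [eval_sub, eval_mul] at hW
  have := mul_pos hx hW
  simp only [mlD_apply, eval_sub, eval_mul, eval_X, eval_C]
  linarith
end

section
/- The multiple Laguerre polynomials of the second kind satisfy the two-parameter Turán inequality L_{n⃗+e⃗_k}^{(α,c⃗)}(x) · L_{n⃗+e⃗_j}^{(α−1,c⃗)}(x) − L_{n⃗}^{(α,c⃗)}(x) · L_{n⃗+e⃗_j+e⃗_k}^{(α−1,c⃗)}(x) > 0 for all x > 0, for every multi-index n⃗ ∈ ℕ^r and all j, k ∈ {1, …, r}, provided α > 0. -/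
open MeasureTheory Polynomial Finset

/-- `P` is the multiple Laguerre polynomial of the second kind for the parameters
`(α, c)` and the multi-index `n`: it is monic of degree `|n|` and satisfies
`∫_0^∞ x^k P(x) x^α exp(-c j x) dx = 0` for all `k < n j` and all `j`. -/
def IsMultipleLaguerreII {r : ℕ} (α : ℝ) (c : Fin r → ℝ) (n : Fin r → ℕ)
    (P : Polynomial ℝ) : Prop :=
  P.Monic ∧ P.natDegree = ∑ i, n i ∧
    ∀ j : Fin r, ∀ k < n j,
      ∫ x in Set.Ioi (0 : ℝ), x ^ k * P.eval x * (x ^ α * Real.exp (-(c j * x))) = 0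

namespace MLag

/-- The moment functional `P ↦ ∫ P x^α e^{-cx}`, given on monomials. -/
noncomputable def J (α c : ℝ) : ℝ[X] →ₗ[ℝ] ℝ :=
  Polynomial.lsum (fun i : ℕ =>
    ((1 / c) ^ (α + 1 + i) * Real.Gamma (α + 1 + i)) • (LinearMap.id : ℝ →ₗ[ℝ] ℝ))

lemma J_monomial (α c : ℝ) (i : ℕ) (a : ℝ) :
    J α c (monomial i a) = ((1 / c) ^ (α + 1 + i) * Real.Gamma (α + 1 + i)) * a := by
  simp [J, Polynomial.lsum_apply]

lemma int_mono {α c : ℝ} (hα : -1 < α) (i : ℕ) (a : ℝ) (hc : 0 < c) :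
    IntegrableOn (fun x : ℝ => (monomial i a).eval x * (x ^ α * Real.exp (-(c * x))))
      (Set.Ioi 0) ∧
    ∫ x in Set.Ioi (0 : ℝ), (monomial i a).eval x * (x ^ α * Real.exp (-(c * x)))
      = J α c (monomial i a) := by
  have hi : (0 : ℝ) ≤ i := Nat.cast_nonneg i
  have hE : Set.EqOn (fun x : ℝ => a * (x ^ (α + i) * Real.exp (-(c * x))))
      (fun x : ℝ => (monomial i a).eval x * (x ^ α * Real.exp (-(c * x)))) (Set.Ioi 0) := by
    intro x hx
    have hx : 0 < x := hx
    simp only [eval_monomial, Real.rpow_add hx, Real.rpow_natCast]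
    ring
  constructor
  · refine IntegrableOn.congr_fun ?_ hE measurableSet_Ioi
    have h := integrableOn_rpow_mul_exp_neg_mul_rpow (p := 1) (s := α + i) (b := c)
      (by linarith) one_pos hc
    simp only [Real.rpow_one, neg_mul] at h
    exact h.const_mul a
  · rw [← setIntegral_congr_fun measurableSet_Ioi hE, integral_const_mul, J_monomial]
    have h := Real.integral_rpow_mul_exp_neg_mul_Ioi (a := α + 1 + i) (r := c)
      (by linarith) hc
    rw [← h, mul_comm]
    congr 2
    ext x
    congr 2
    ring

lemma int_eq_J {α c : ℝ} (hα : -1 < α) (hc : 0 < c) (P : ℝ[X]) :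
    IntegrableOn (fun x : ℝ => P.eval x * (x ^ α * Real.exp (-(c * x)))) (Set.Ioi 0) ∧
    ∫ x in Set.Ioi (0 : ℝ), P.eval x * (x ^ α * Real.exp (-(c * x))) = J α c P := by
  induction P using Polynomial.induction_on' with
  | add p q hp hq =>
    simp only [eval_add, add_mul, map_add]
    refine ⟨hp.1.add hq.1, ?_⟩
    rw [← hp.2, ← hq.2]
    exact integral_add hp.1 hq.1
  | monomial i a => exact int_mono hα i a hc

lemma J_X (α c : ℝ) (P : ℝ[X]) : J α c (X * P) = J (α + 1) c P := by
  induction P using Polynomial.induction_on' with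
  | add p q hp hq => simp only [mul_add, map_add, hp, hq]
  | monomial i a =>
    rw [X_mul_monomial, J_monomial, J_monomial]
    have : α + 1 + ((i + 1 : ℕ) : ℝ) = α + 1 + 1 + i := by push_cast; ring
    rw [this]

lemma J_ibp {α c : ℝ} (hα : -1 < α) (hc : 0 < c) (P : ℝ[X]) :
    J α c (X * derivative P) = c * J α c (X * P) - (α + 1) * J α c P := by
  induction P using Polynomial.induction_on' with
  | add p q hp hq => simp only [mul_add, map_add, hp, hq]; ring
  | monomial i a =>
    have hi : (0 : ℝ) ≤ i := Nat.cast_nonneg i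
    have h1 : X * derivative (monomial i a) = monomial i (a * i) := by
      rw [derivative_monomial, X_mul_monomial]
      rcases i with _ | i
      · simp
      · simp
    rw [h1, X_mul_monomial, J_monomial, J_monomial, J_monomial]
    have : α + 1 + ((i + 1 : ℕ) : ℝ) = α + 1 + i + 1 := by push_cast; ring
    rw [this, Real.Gamma_add_one (by linarith), Real.rpow_add_one (by positivity)]
    field_simp
    ring

/-- Raising operator. -/
noncomputable def R (c β : ℝ) (Q : ℝ[X]) : ℝ[X] := (C c * X - C β) * Q - X * derivative Q

lemma J_R {α c d : ℝ} (hα : -1 < α) (hd : 0 < d) (Q : ℝ[X]) (k : ℕ) :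
    J α d (X ^ k * R c (α + 1) Q)
      = (c - d) * J (α + 1) d (X ^ k * Q) + k * J α d (X ^ k * Q) := by
  have h := J_ibp hα hd (X ^ k * Q)
  have e1 : X ^ k * R c (α + 1) Q = c • (X * (X ^ k * Q)) - (α + 1) • (X ^ k * Q)
      - (X * derivative (X ^ k * Q) - (k : ℝ) • (X ^ k * Q)) := by
    simp only [R, smul_eq_C_mul, derivative_mul, derivative_X_pow]
    rcases k with _ | k
    · simp; ring
    · simp; ring
  rw [e1]
  simp only [map_sub, map_smul, smul_eq_mul, h, ← J_X]
  ring

lemma exists_R (c β : ℝ) (hc : 0 < c) (P : ℝ[X]) : ∃ Q e, P = R c β Q + C e := by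
  induction P using Polynomial.induction_on' with
  | add p q hp hq =>
    obtain ⟨Q, e, h⟩ := hp
    obtain ⟨Q', e', h'⟩ := hq
    refine ⟨Q + Q', e + e', ?_⟩
    rw [h, h']; simp only [R, derivative_add, C_add]; ring
  | monomial i a =>
    induction i generalizing a with
    | zero => exact ⟨0, a, by simp [R]⟩
    | succ i ih =>
      obtain ⟨Q, e, h⟩ := ih ((β + i) * (a / c))
      refine ⟨monomial i (a / c) + Q, e, ?_⟩
      have : R c β (monomial i (a / c) + Q) = R c β (monomial i (a / c)) + R c β Q := by
        simp only [R, derivative_add]; ring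
      rw [this, add_assoc, ← h]
      have h1 : X * derivative (monomial i (a / c)) = monomial i ((a / c) * i) := by
        rw [derivative_monomial, X_mul_monomial]
        rcases i with _ | i
        · simp
        · simp
      have h2 : (C c * X - C β) * monomial i (a / c)
          = monomial (i + 1) a - monomial i (β * (a / c)) := by
        rw [sub_mul, mul_assoc, X_mul_monomial, C_mul_monomial, C_mul_monomial]
        congr 2
        field_simp
      rw [R, h1, h2, sub_sub, ← map_add, sub_add_eq_add_sub, add_sub_assoc, ← map_sub]
      have : (β + i) * (a / c) - (β * (a / c) + a / c * i) = 0 := by ring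
      rw [this]; simp

lemma root_of_signs (S : ℝ[X]) {u v : ℝ} (huv : u < v) (h : S.eval u * S.eval v < 0) :
    ∃ z, u < z ∧ z < v ∧ S.eval z = 0 := by
  have hcont : ContinuousOn (fun x => S.eval x) (Set.Icc u v) := S.continuous.continuousOn
  rcases mul_neg_iff.1 h with ⟨h1, h2⟩ | ⟨h1, h2⟩
  · obtain ⟨z, hz, hz0⟩ := intermediate_value_Ioo' huv.le hcont ⟨h2, h1⟩
    exact ⟨z, hz.1, hz.2, hz0⟩
  · obtain ⟨z, hz, hz0⟩ := intermediate_value_Ioo huv.le hcont ⟨h1, h2⟩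
    exact ⟨z, hz.1, hz.2, hz0⟩

/-- The function to which Rolle is applied. -/
noncomputable def F (c β : ℝ) (Q : ℝ[X]) (x : ℝ) : ℝ := x ^ β * Real.exp (-(c * x)) * Q.eval x

lemma F_cont (c β : ℝ) (hβ : 0 < β) (Q : ℝ[X]) : Continuous (F c β Q) := by
  unfold F
  have h1 : Continuous fun x : ℝ => x ^ β := Real.continuous_rpow_const hβ.le
  have h2 := Q.continuous
  fun_prop

lemma F_deriv (c β : ℝ) (Q : ℝ[X]) {x : ℝ} (hx : 0 < x) :
    HasDerivAt (F c β Q) (-(x ^ (β - 1) * Real.exp (-(c * x)) * (R c β Q).eval x)) x := by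
  unfold F
  have h1 : HasDerivAt (fun x : ℝ => x ^ β) (β * x ^ (β - 1)) x :=
    Real.hasDerivAt_rpow_const (Or.inl hx.ne')
  have h2 : HasDerivAt (fun x : ℝ => Real.exp (-(c * x))) (Real.exp (-(c * x)) * (-(c * 1))) x :=
    (((hasDerivAt_id x).const_mul c).neg).exp
  have h := (h1.mul h2).mul (Q.hasDerivAt x)
  refine h.congr_deriv ?_
  have hb : x ^ β = x ^ (β - 1) * x := by
    rw [← Real.rpow_add_one hx.ne']; congr 1; ring
  simp only [Pi.mul_apply, R, eval_sub, eval_mul, eval_C, eval_X, hb]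
  ring

lemma F_lim (c β : ℝ) (hc : 0 < c) (Q : ℝ[X]) :
    Filter.Tendsto (F c β Q) Filter.atTop (nhds 0) := by
  induction Q using Polynomial.induction_on' with
  | add p q hp hq =>
    have h := hp.add hq
    rw [add_zero] at h
    refine h.congr fun x => ?_
    simp only [F, eval_add]; ring
  | monomial i a =>
    have h := (tendsto_rpow_mul_exp_neg_mul_atTop_nhds_zero (β + i) c hc).const_mul a
    rw [mul_zero] at h
    refine h.congr' ?_
    filter_upwards [Filter.eventually_gt_atTop 0] with x hx
    simp only [F, eval_monomial, Real.rpow_add hx, Real.rpow_natCast, neg_mul]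
    ring

lemma mvt (c β : ℝ) (hβ : 0 < β) (Q D S : ℝ[X]) (hP : R c β Q = D * S)
    (hD : ∀ x, 0 ≤ D.eval x) {a y z : ℝ} (ha : 0 ≤ a) (hay : a < y) (hyz : y < z)
    (hFa : F c β Q a = 0) (h : F c β Q y * (F c β Q z - F c β Q y) < 0) :
    ∃ w, a < w ∧ w < z ∧ S.eval w = 0 := by
  obtain ⟨u, hu, hu'⟩ := exists_hasDerivAt_eq_slope (F c β Q) _ hay
    (F_cont c β hβ Q).continuousOn (fun x hx => F_deriv c β Q (ha.trans_lt hx.1))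
  obtain ⟨v, hv, hv'⟩ := exists_hasDerivAt_eq_slope (F c β Q) _ hyz
    (F_cont c β hβ Q).continuousOn (fun x hx => F_deriv c β Q ((ha.trans_lt hay).trans hx.1))
  have hu0 : 0 < u := ha.trans_lt hu.1
  have hv0 : 0 < v := (ha.trans_lt hay).trans hv.1
  have key : ((F c β Q y - F c β Q a) / (y - a)) * ((F c β Q z - F c β Q y) / (z - y)) < 0 := by
    rw [hFa, sub_zero, div_mul_div_comm]
    exact div_neg_of_neg_of_pos h (mul_pos (by linarith) (by linarith))
  rw [← hu', ← hv', hP, eval_mul, eval_mul] at key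
  have huv : u < v := hu.2.trans hv.1
  obtain ⟨w, h1, h2, h3⟩ := root_of_signs S huv (by
    by_contra hcon
    push Not at hcon
    have e : -(u ^ (β - 1) * Real.exp (-(c * u)) * (D.eval u * S.eval u)) *
        -(v ^ (β - 1) * Real.exp (-(c * v)) * (D.eval v * S.eval v)) =
        (u ^ (β - 1) * Real.exp (-(c * u)) * (v ^ (β - 1) * Real.exp (-(c * v)))) *
        (D.eval u * D.eval v) * (S.eval u * S.eval v) := by ring
    rw [e] at key
    have := hD u
    have := hD v
    have : 0 ≤ (u ^ (β - 1) * Real.exp (-(c * u)) * (v ^ (β - 1) * Real.exp (-(c * v)))) *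
        (D.eval u * D.eval v) * (S.eval u * S.eval v) := by positivity
    linarith)
  exact ⟨w, hu.1.trans h1, h2.trans hv.2, h3⟩

lemma exists_nonroot (Q : ℝ[X]) (hQ : Q ≠ 0) {a b : ℝ} (hab : a < b) :
    ∃ y, a < y ∧ y < b ∧ Q.eval y ≠ 0 := by
  by_contra hcon
  push Not at hcon
  apply hQ
  refine Polynomial.eq_zero_of_infinite_isRoot Q ((Set.Ioo_infinite hab).mono ?_)
  intro y hy
  exact hcon y hy.1 hy.2

lemma rolle (c β : ℝ) (hc : 0 < c) (hβ : 0 < β) (Q D S : ℝ[X]) (hQ : Q ≠ 0)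
    (hP : R c β Q = D * S) (hD : ∀ x, 0 ≤ D.eval x) (s : Finset ℝ)
    (hs : ∀ z ∈ s, 0 < z ∧ Q.eval z = 0) :
    ∃ t : Finset ℝ, t.card = s.card + 1 ∧ ∀ z ∈ t, 0 < z ∧ S.eval z = 0 := by
  have hF0 : ∀ a ∈ insert 0 s, 0 ≤ a ∧ F c β Q a = 0 := by
    intro a ha
    rcases Finset.mem_insert.1 ha with rfl | ha
    · simp [F, Real.zero_rpow hβ.ne']
    · exact ⟨(hs a ha).1.le, by simp [F, (hs a ha).2]⟩
  have hFne : ∀ y, 0 < y → Q.eval y ≠ 0 → F c β Q y ≠ 0 := by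
    intro y hy h
    have := Real.rpow_pos_of_pos hy β
    unfold F
    positivity
  have hex : ∀ a ∈ insert 0 s, ∃ g, a < g ∧ S.eval g = 0 ∧ ∀ b ∈ s, a < b → g < b := by
    intro a ha
    obtain ⟨ha0, hFa⟩ := hF0 a ha
    by_cases hne : (s.filter (fun b => a < b)).Nonempty
    · have hm := Finset.min'_mem _ hne
      set m := (s.filter (fun b => a < b)).min' hne with hmdef
      rw [Finset.mem_filter] at hm
      obtain ⟨y, hy1, hy2, hy3⟩ := exists_nonroot Q hQ hm.2
      have hFm := (hF0 m (Finset.mem_insert_of_mem hm.1)).2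
      have hFy := hFne y (ha0.trans_lt hy1) hy3
      obtain ⟨w, h1, h2, h3⟩ := mvt c β hβ Q D S hP hD ha0 hy1 hy2 hFa (by
        rw [hFm]
        have := mul_self_pos.2 hFy
        linarith)
      refine ⟨w, h1, h3, fun b hb hab => h2.trans_le ?_⟩
      exact Finset.min'_le _ _ (Finset.mem_filter.2 ⟨hb, hab⟩)
    · obtain ⟨y, hy1, hy2, hy3⟩ := exists_nonroot Q hQ (lt_add_one a)
      have hFy := hFne y (ha0.trans_lt hy1) hy3
      have hlim := (F_lim c β hc Q).const_mul (F c β Q y)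
      rw [mul_zero] at hlim
      obtain ⟨z, hz1, hz2⟩ := ((hlim.eventually_lt_const (mul_self_pos.2 hFy)).and
        (Filter.eventually_gt_atTop y)).exists
      obtain ⟨w, h1, h2, h3⟩ := mvt c β hβ Q D S hP hD ha0 hy1 hz2 hFa (by
        rw [mul_sub]; linarith)
      refine ⟨w, h1, h3, fun b hb hab => ?_⟩
      exact absurd ⟨b, Finset.mem_filter.2 ⟨hb, hab⟩⟩ hne
  choose! g hg1 hg2 hg3 using hex
  have h0 : (0 : ℝ) ∉ s := fun h => lt_irrefl _ (hs 0 h).1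
  have hlt : ∀ a ∈ insert 0 s, ∀ b ∈ insert 0 s, a < b → g a < g b := by
    intro a ha b hb hab
    have hbs : b ∈ s := by
      rcases Finset.mem_insert.1 hb with rfl | hb'
      · exact absurd (hF0 a ha).1 (not_le.2 hab)
      · exact hb'
    exact (hg3 a ha b hbs hab).trans (hg1 b hb)
  refine ⟨(insert 0 s).image g, ?_, ?_⟩
  · rw [Finset.card_image_of_injOn, Finset.card_insert_of_notMem h0]
    intro a ha b hb hab
    rcases lt_trichotomy a b with h | h | h
    · exact absurd hab (hlt a ha b hb h).ne
    · exact h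
    · exact absurd hab (hlt b hb a ha h).ne'
  · intro z hz
    obtain ⟨a, ha, rfl⟩ := Finset.mem_image.1 hz
    exact ⟨(hF0 a ha).1.trans_lt (hg1 a ha), hg2 a ha⟩

/-- Orthogonality conditions. -/
def Orth {r : ℕ} (α : ℝ) (c : Fin r → ℝ) (n : Fin r → ℕ) (P : ℝ[X]) : Prop :=
  ∀ j, ∀ k < n j, J α (c j) (X ^ k * P) = 0

lemma J_one_ne {α c : ℝ} (hα : -1 < α) (hc : 0 < c) (e : ℝ) (h : J α c (C e) = 0) : e = 0 := by
  rw [← monomial_zero_left, J_monomial] at h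
  have h1 : 0 < Real.Gamma (α + 1 + ((0 : ℕ) : ℝ)) := Real.Gamma_pos_of_pos (by simp; linarith)
  have h2 : 0 < (1 / c) ^ (α + 1 + ((0 : ℕ) : ℝ)) := Real.rpow_pos_of_pos (by positivity) _
  rcases mul_eq_zero.1 h with h | h
  · exact absurd h (mul_pos h2 h1).ne'
  · exact h

lemma main {r : ℕ} (c : Fin r → ℝ) (hc : ∀ i, 0 < c i) (hcinj : Function.Injective c) (N : ℕ) :
    ∀ (α : ℝ), -1 < α → ∀ (n : Fin r → ℕ), ∑ i, n i = N → ∀ P : ℝ[X], P ≠ 0 → Orth α c n P →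
    ∀ D S : ℝ[X], P = D * S → (∀ x, 0 ≤ D.eval x) →
    ∃ t : Finset ℝ, t.card = N ∧ ∀ z ∈ t, 0 < z ∧ S.eval z = 0 := by
  induction N with
  | zero => intros; exact ⟨∅, by simp⟩
  | succ N ih =>
    intro α hα n hn P hP0 hP D S hDS hD
    obtain ⟨j, hj⟩ : ∃ j, 0 < n j := by
      by_contra hcon
      push Not at hcon
      have : ∑ i, n i = 0 := Finset.sum_eq_zero fun i _ => Nat.le_zero.1 (hcon i)
      omega
    obtain ⟨Q, e, hQ⟩ := exists_R (c j) (α + 1) (hc j) P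
    have he : e = 0 := by
      apply J_one_ne hα (hc j)
      have h1 := hP j 0 hj
      have h2 := J_R (c := c j) hα (hc j) Q 0
      simp only [pow_zero, one_mul, sub_self, zero_mul, Nat.cast_zero, add_zero] at h1 h2
      rwa [hQ, map_add, h2, zero_add] at h1
    subst he
    rw [C_0, add_zero] at hQ
    have hQ0 : Q ≠ 0 := by
      rintro rfl
      apply hP0
      rw [hQ]; simp [R]
    have hsum : ∑ i, Function.update n j (n j - 1) i = N := by
      have h1 := Finset.add_sum_erase _ n (Finset.mem_univ j)
      have h2 := Finset.add_sum_erase _ (Function.update n j (n j - 1)) (Finset.mem_univ j)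
      have h3 : ∑ i ∈ univ.erase j, Function.update n j (n j - 1) i = ∑ i ∈ univ.erase j, n i :=
        Finset.sum_congr rfl fun i hi => by
          rw [Function.update_of_ne (Finset.ne_of_mem_erase hi)]
      rw [Function.update_self] at h2
      omega
    have horth : Orth (α + 1) c (Function.update n j (n j - 1)) Q := by
      intro i k hk
      by_cases hij : i = j
      · subst hij
        rw [Function.update_self] at hk
        have h1 := hP i (k + 1) (by omega)
        rw [hQ, J_R hα (hc i), sub_self, zero_mul, zero_add, pow_succ', mul_assoc, J_X] at h1
        rcases mul_eq_zero.1 h1 with h | h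
        · exact absurd h (by positivity)
        · exact h
      · rw [Function.update_of_ne hij] at hk
        have hne : c j - c i ≠ 0 := sub_ne_zero.2 fun h => hij (hcinj h).symm
        induction k with
        | zero =>
          have h1 := hP i 0 hk
          rw [hQ, J_R hα (hc i)] at h1
          simpa [hne] using h1
        | succ k ihk =>
          have h1 := hP i (k + 1) hk
          have h2 := ihk (by omega)
          rw [hQ, J_R hα (hc i)] at h1
          rw [pow_succ' X k, mul_assoc X, J_X α, h2, mul_zero, add_zero, ← mul_assoc X,
            ← pow_succ'] at h1
          exact (mul_eq_zero.1 h1).resolve_left hne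
    obtain ⟨s, hs1, hs2⟩ := ih (α + 1) (by linarith) _ hsum Q hQ0 horth 1 Q (by simp) (by simp)
    obtain ⟨t, ht1, ht2⟩ := rolle (c j) (α + 1) (hc j) (by linarith) Q D S hQ0
      (hQ ▸ hDS) hD s hs2
    exact ⟨t, by omega, ht2⟩

lemma orth_of {r : ℕ} {α : ℝ} (hα : -1 < α) {c : Fin r → ℝ} (hc : ∀ i, 0 < c i) {n : Fin r → ℕ}
    {P : ℝ[X]} (h : IsMultipleLaguerreII α c n P) : Orth α c n P := by
  intro j k hk
  rw [← (int_eq_J hα (hc j) _).2]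
  simpa using h.2.2 j k hk

lemma card_le {S : ℝ[X]} (hS : S ≠ 0) (t : Finset ℝ) (ht : ∀ z ∈ t, 0 < z ∧ S.eval z = 0) :
    t.card ≤ S.natDegree := by
  refine Polynomial.card_le_degree_of_subset_roots ?_
  intro z hz
  exact (mem_roots hS).2 (ht z hz).2

lemma sum_unit {r : ℕ} (n : Fin r → ℕ) (k : Fin r) :
    ∑ i, (n + unitMI k) i = ∑ i, n i + 1 := by
  simp [unitMI, Finset.sum_add_distrib]

lemma raise {r : ℕ} {α : ℝ} (hα : 0 < α) {c : Fin r → ℝ} (hc : ∀ i, 0 < c i)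
    (hcinj : Function.Injective c) (j : Fin r) {n : Fin r → ℕ} {A A' : ℝ[X]}
    (hA : IsMultipleLaguerreII α c n A)
    (hA' : IsMultipleLaguerreII (α - 1) c (n + unitMI j) A') :
    C (c j) * A' = R (c j) α A := by
  by_contra hne
  have ho := orth_of (by linarith) hc hA
  have ho' := orth_of (by linarith) hc hA'
  have hR : Orth (α - 1) c (n + unitMI j) (R (c j) α A) := by
    intro i k hk
    have h := J_R (α := α - 1) (c := c j) (by linarith) (hc i) A k
    rw [sub_add_cancel] at h
    rw [h]
    have hk' : k < n i + if i = j then 1 else 0 := hk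
    have h2 : (k : ℝ) * J (α - 1) (c i) (X ^ k * A) = 0 := by
      rcases k with _ | k
      · simp
      · rw [pow_succ', mul_assoc, J_X, sub_add_cancel, ho i k (by split_ifs at hk' <;> omega),
          mul_zero]
    rw [h2, add_zero]
    by_cases hij : i = j
    · rw [hij, sub_self, zero_mul]
    · rw [if_neg hij] at hk'
      rw [ho i k (by omega), mul_zero]
  have hdiff : Orth (α - 1) c (n + unitMI j) (C (c j) * A' - R (c j) α A) := by
    intro i k hk
    rw [mul_sub, map_sub, hR i k hk, sub_zero, mul_left_comm, ← smul_eq_C_mul, map_smul,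
      ho' i k hk, smul_zero]
  have h0 := sub_ne_zero.2 hne
  obtain ⟨t, ht1, ht2⟩ := main c hc hcinj _ (α - 1) (by linarith) _ (sum_unit n j) _ h0 hdiff 1 _
    (one_mul _).symm (by simp)
  have hcard := card_le h0 t ht2
  rw [ht1] at hcard
  have hdA := hA.2.1
  have hdA' := hA'.2.1
  rw [sum_unit] at hdA'
  have hmA := hA.1
  have hmA' := hA'.1
  set N := ∑ i, n i
  have hdeg : (C (c j) * A' - R (c j) α A).natDegree ≤ N := by
    rw [natDegree_le_iff_coeff_eq_zero]
    intro m hm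
    obtain ⟨m, rfl⟩ : ∃ m', m = m' + 1 := ⟨m - 1, by omega⟩
    have e : R (c j) α A = C (c j) * (X * A) - C α * A - X * derivative A := by
      unfold R; ring
    rw [e]
    simp only [coeff_sub, coeff_C_mul, coeff_X_mul, coeff_derivative]
    have z1 : A.coeff (m + 1) = 0 := coeff_eq_zero_of_natDegree_lt (by omega)
    rw [z1]
    have z2 : A'.coeff (m + 1) = A.coeff m := by
      rcases eq_or_lt_of_le (show N ≤ m by omega) with h | h
      · have a1 : A.coeff m = 1 := by rw [← h, ← hdA]; exact hmA
        have a2 : A'.coeff (m + 1) = 1 := by rw [← h, ← hdA']; exact hmA'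
        rw [a1, a2]
      · rw [coeff_eq_zero_of_natDegree_lt (by omega), coeff_eq_zero_of_natDegree_lt (by omega)]
    rw [z2]; ring
  omega

lemma exists_comb (a b a' b' : ℝ) (h : a * b' = b * a') :
    ∃ p q : ℝ, (p ≠ 0 ∨ q ≠ 0) ∧ p * a + q * b = 0 ∧ p * a' + q * b' = 0 := by
  by_cases h1 : a = 0 ∧ b = 0
  · obtain ⟨rfl, rfl⟩ := h1
    by_cases h2 : a' = 0 ∧ b' = 0
    · obtain ⟨rfl, rfl⟩ := h2
      exact ⟨1, 0, by simp⟩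
    · refine ⟨b', -a', ?_, by ring, by ring⟩
      rw [neg_ne_zero]; tauto
  · refine ⟨b, -a, ?_, by ring, by linarith⟩
    rw [neg_ne_zero]; tauto

lemma wronsk_ne {r : ℕ} {α : ℝ} (hα : 0 < α) {c : Fin r → ℝ} (hc : ∀ i, 0 < c i)
    (hcinj : Function.Injective c) (k : Fin r) {n : Fin r → ℕ} {A B : ℝ[X]}
    (hA : IsMultipleLaguerreII α c n A)
    (hB : IsMultipleLaguerreII α c (n + unitMI k) B) (x : ℝ) :
    A.eval x * (derivative B).eval x - B.eval x * (derivative A).eval x ≠ 0 := by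
  intro h
  obtain ⟨p, q, hpq, h1, h2⟩ := exists_comb _ _ _ _ (sub_eq_zero.1 h)
  have ho := orth_of (by linarith) hc hA
  have ho' := orth_of (by linarith) hc hB
  have hdA := hA.2.1
  have hdB := hB.2.1
  rw [sum_unit] at hdB
  have hmA := hA.1
  have hmB := hB.1
  set P : ℝ[X] := C p * A + C q * B with hPdef
  have hP0 : P ≠ 0 := by
    intro h0
    have hq : q = 0 := by
      have := congrArg (fun T => coeff T B.natDegree) h0
      simpa [hPdef, hmB.coeff_natDegree,
        coeff_eq_zero_of_natDegree_lt (show A.natDegree < B.natDegree by omega)] using this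
    have hp : p = 0 := by
      have := congrArg (fun T => coeff T A.natDegree) h0
      simpa [hPdef, hq, hmA.coeff_natDegree] using this
    tauto
  have hPo : Orth α c n P := by
    intro i m hm
    have hm' : m < (n + unitMI k) i := lt_of_lt_of_le hm (by simp)
    rw [hPdef, mul_add, map_add, mul_left_comm, mul_left_comm _ (C q), ← smul_eq_C_mul,
      ← smul_eq_C_mul, map_smul, map_smul, ho i m hm, ho' i m hm']
    simp
  have hPd : P.natDegree ≤ ∑ i, n i + 1 := by
    refine natDegree_add_le_of_degree_le ?_ ?_
    · exact (natDegree_C_mul_le _ _).trans (by omega)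
    · exact (natDegree_C_mul_le _ _).trans (by omega)
  obtain ⟨T, hT⟩ : (X - C x) ∣ P := dvd_iff_isRoot.2 (by simp [hPdef, h1])
  have hT0 : T.eval x = 0 := by
    have : (derivative P).eval x = 0 := by simp [hPdef, h2]
    rw [hT] at this
    simpa using this
  obtain ⟨S, hS⟩ : (X - C x) ∣ T := dvd_iff_isRoot.2 hT0
  have hPS : P = ((X - C x) * (X - C x)) * S := by rw [hT, hS]; ring
  obtain ⟨t, ht1, ht2⟩ := main c hc hcinj _ α (by linarith) _ rfl P hP0 hPo _ S hPS
    (fun y => by simpa using mul_self_nonneg (y - x))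
  have hS0 : S ≠ 0 := by
    rintro rfl
    exact hP0 (by rw [hPS, mul_zero])
  have := card_le hS0 t ht2
  have hX : (X - C x : ℝ[X]) ≠ 0 := X_sub_C_ne_zero x
  rw [hPS, natDegree_mul (mul_ne_zero hX hX) hS0, natDegree_mul hX hX, natDegree_X_sub_C] at hPd
  omega

lemma wronsk_pos {r : ℕ} {α : ℝ} (hα : 0 < α) {c : Fin r → ℝ} (hc : ∀ i, 0 < c i)
    (hcinj : Function.Injective c) (k : Fin r) {n : Fin r → ℕ} {A B : ℝ[X]}
    (hA : IsMultipleLaguerreII α c n A)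
    (hB : IsMultipleLaguerreII α c (n + unitMI k) B) (x : ℝ) (hx : 0 < x) :
    0 < x * (A.eval x * (derivative B).eval x - B.eval x * (derivative A).eval x) := by
  set V : ℝ[X] := A * (X * derivative B) - B * (X * derivative A) with hV
  have hev : ∀ y, V.eval y =
      y * (A.eval y * (derivative B).eval y - B.eval y * (derivative A).eval y) := by
    intro y; simp [hV]; ring
  have hne : ∀ y, 0 < y → V.eval y ≠ 0 := fun y hy => by
    rw [hev]; exact mul_ne_zero hy.ne' (wronsk_ne hα hc hcinj k hA hB y)
  rw [← hev]
  have hdA := hA.2.1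
  have hdB := hB.2.1
  rw [sum_unit] at hdB
  have hmA := hA.1
  have hmB := hB.1
  set N := ∑ i, n i
  have hXd : ∀ (T : ℝ[X]) (m : ℕ), (X * derivative T).coeff m = m * T.coeff m := by
    intro T m
    rcases m with _ | m
    · simp
    · rw [coeff_X_mul, coeff_derivative]; push_cast; ring
  have hXdeg : ∀ (T : ℝ[X]), (X * derivative T).natDegree ≤ T.natDegree := by
    intro T
    rw [natDegree_le_iff_coeff_eq_zero]
    intro m hm
    rw [hXd, coeff_eq_zero_of_natDegree_lt hm, mul_zero]
  have d1 : (X * derivative B).natDegree ≤ N + 1 := hdB ▸ hXdeg B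
  have d2 : (X * derivative A).natDegree ≤ N := hdA ▸ hXdeg A
  have hVd : V.natDegree ≤ N + (N + 1) := by
    have m1 : (A * (X * derivative B)).natDegree ≤ N + (N + 1) :=
      natDegree_mul_le.trans (by omega)
    have m2 : (B * (X * derivative A)).natDegree ≤ N + (N + 1) :=
      natDegree_mul_le.trans (by omega)
    exact (natDegree_sub_le _ _).trans (max_le m1 m2)
  have cA : A.coeff N = 1 := by rw [← hdA]; exact hmA
  have cB : B.coeff (N + 1) = 1 := by rw [← hdB]; exact hmB
  have hVc : V.coeff (N + (N + 1)) = 1 := by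
    rw [hV, coeff_sub, coeff_mul_add_eq_of_natDegree_le hdA.le d1, add_comm N (N + 1),
      coeff_mul_add_eq_of_natDegree_le hdB.le d2, hXd, hXd, cA, cB]
    push_cast; ring
  have hVmon : V.Monic := monic_of_natDegree_le_of_coeff_eq_one _ hVd hVc
  have hVdeg : V.natDegree = N + (N + 1) :=
    le_antisymm hVd (le_natDegree_of_ne_zero (by rw [hVc]; exact one_ne_zero))
  have hlim : Filter.Tendsto (fun y => V.eval y) Filter.atTop Filter.atTop := by
    refine V.tendsto_atTop_of_leadingCoeff_nonneg ?_ ?_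
    · exact natDegree_pos_iff_degree_pos.1 (by omega)
    · rw [hVmon.leadingCoeff]; exact zero_le_one
  by_contra hcon
  have hneg : V.eval x < 0 := lt_of_le_of_ne (not_lt.1 hcon) (hne x hx)
  obtain ⟨y, hy1, hy2⟩ := ((hlim.eventually_gt_atTop 0).and (Filter.eventually_gt_atTop x)).exists
  obtain ⟨w, h1, h2, h3⟩ := root_of_signs V hy2 (mul_neg_of_neg_of_pos hneg hy1)
  exact hne w (hx.trans h1) h3

end MLag

/-- for `α > 0`, the multiple Laguerre polynomials of the second kind
satisfy the two-parameter Turán inequality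
`L^{(α,c)}_{n+e_k}(x) L^{(α−1,c)}_{n+e_j}(x) − L^{(α,c)}_{n}(x) L^{(α−1,c)}_{n+e_j+e_k}(x) > 0`
for all `x > 0`. -/
theorem multipleLaguerreII_turan {r : ℕ} (hr : 1 ≤ r)
    (α : ℝ) (hα : 0 < α)
    (c : Fin r → ℝ) (hc : ∀ i, 0 < c i) (hcinj : Function.Injective c)
    (j k : Fin r)
    (L L' : (Fin r → ℕ) → Polynomial ℝ)
    (hL : ∀ n, IsMultipleLaguerreII α c n (L n))
    (hL' : ∀ n, IsMultipleLaguerreII (α - 1) c n (L' n))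
    (n : Fin r → ℕ) (x : ℝ) (hx : 0 < x) :
    0 < (L (n + unitMI k)).eval x * (L' (n + unitMI j)).eval x -
        (L n).eval x * (L' (n + unitMI j + unitMI k)).eval x := by
  have e1 := MLag.raise hα hc hcinj j (hL n) (hL' _)
  have e2 := MLag.raise hα hc hcinj j (hL (n + unitMI k)) (hL' _)
  rw [add_right_comm] at e2
  have hW := MLag.wronsk_pos hα hc hcinj k (hL n) (hL (n + unitMI k)) x hx
  have f1 := congrArg (Polynomial.eval x) e1
  have f2 := congrArg (Polynomial.eval x) e2
  simp only [MLag.R, eval_sub, eval_mul, eval_C, eval_X] at f1 f2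
  refine pos_of_mul_pos_right (a := c j) ?_ (hc j).le
  have : c j * ((L (n + unitMI k)).eval x * (L' (n + unitMI j)).eval x -
        (L n).eval x * (L' (n + unitMI j + unitMI k)).eval x) =
      x * ((L n).eval x * (derivative (L (n + unitMI k))).eval x -
        (L (n + unitMI k)).eval x * (derivative (L n)).eval x) := by
    linear_combination (L (n + unitMI k)).eval x * f1 - (L n).eval x * f2
  rw [this]
  exact hW
end

section
/- For every multi-index n⃗ ∈ ℕ^r and every k ∈ {1, …, r}, the multiple Laguerre polynomials of the first kind satisfy x·( L_{n⃗}^{α⃗}(x) · (L_{n⃗+e⃗_k}^{α⃗})′(x) − (L_{n⃗}^{α⃗})′(x) · L_{n⃗+e⃗_k}^{α⃗}(x) ) > 0 for all x > 0; equivalently, the determinant of the 2×2 matrix with first row (L_{n⃗}^{α⃗}(x), L_{n⃗+e⃗_k}^{α⃗}(x)) and second row (x·(L_{n⃗}^{α⃗})′(x), x·(L_{n⃗+e⃗_k}^{α⃗})′(x)) is strictly positive for x > 0. -/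
open MeasureTheory Polynomial Finset

noncomputable def lagD (a : ℝ) (R : ℝ[X]) : ℝ[X] := X * derivative R + C a * R - X * R

noncomputable def lagM (b : ℝ) : ℝ[X] →ₗ[ℝ] ℝ :=
  Polynomial.lsum (fun k => Real.Gamma (b + k) • LinearMap.id)

lemma lagM_monomial (b : ℝ) (k : ℕ) (c : ℝ) :
    lagM b (monomial k c) = Real.Gamma (b + k) * c := by
  simp [lagM, Polynomial.lsum_apply]

lemma lagD_add (a : ℝ) (P Q : ℝ[X]) : lagD a (P + Q) = lagD a P + lagD a Q := by
  simp only [lagD, derivative_add]; ring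

lemma lagD_monomial (a : ℝ) (k : ℕ) (c : ℝ) :
    lagD a (monomial k c) = monomial k ((k + a) * c) - monomial (k + 1) c := by
  rw [lagD, X_mul_monomial, C_mul_monomial]
  congr 1
  rcases k with _ | k
  · simp
  · rw [derivative_monomial, X_mul_monomial, Nat.add_sub_cancel, ← map_add]
    congr 1; push_cast; ring

lemma lagM_lagD (a b : ℝ) (hb : 0 < b) (R : ℝ[X]) :
    lagM b (lagD a R) = (a - b) * lagM b R := by
  induction R using Polynomial.induction_on' with
  | add p q hp hq => rw [lagD_add, map_add, hp, hq, map_add]; ring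
  | monomial k c =>
    rw [lagD_monomial, map_sub, lagM_monomial, lagM_monomial, lagM_monomial]
    have : Real.Gamma (b + (k + 1 : ℕ)) = (b + k) * Real.Gamma (b + k) := by
      rw [← Real.Gamma_add_one (by positivity)]; congr 1; push_cast; ring
    rw [this]; ring

lemma lagD_surj_mod (a : ℝ) (P : ℝ[X]) : ∃ R c, P = lagD a R + C c := by
  induction P using Polynomial.induction_on' with
  | add p q hp hq =>
    obtain ⟨R, c, h⟩ := hp
    obtain ⟨R', c', h'⟩ := hq
    refine ⟨R + R', c + c', ?_⟩
    rw [lagD_add, h, h', C_add]; ring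
  | monomial k d =>
    induction k generalizing d with
    | zero => exact ⟨0, d, by simp [lagD]⟩
    | succ k ih =>
      obtain ⟨R, c, h⟩ := ih ((k + a) * d)
      refine ⟨R + monomial k (-d), c, ?_⟩
      rw [lagD_add, lagD_monomial, add_right_comm, ← h]
      simp

lemma lagD_surj (a : ℝ) (ha : 0 < a) (P : ℝ[X]) (hP : lagM a P = 0) : ∃ R, P = lagD a R := by
  obtain ⟨R, c, h⟩ := lagD_surj_mod a P
  have h2 := hP
  rw [h, map_add, lagM_lagD a a ha, ← monomial_zero_left, lagM_monomial] at h2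
  have h3 := Real.Gamma_pos_of_pos ha
  have hc : c = 0 := by
    simp at h2
    rcases h2 with h2 | h2
    · exact absurd h2 h3.ne'
    · exact h2
  exact ⟨R, by simpa [hc] using h⟩

def Alt (m : ℕ) (P : ℝ[X]) : Prop :=
  ∃ (y : ℕ → ℝ) (c : ℝ), (∀ i ≤ m, 0 < y i) ∧ (∀ i < m, y i < y (i + 1)) ∧
    ∀ i ≤ m, 0 < c * (-1) ^ i * P.eval (y i)

lemma lag_hasDeriv (a : ℝ) (R : ℝ[X]) (x : ℝ) (hx : 0 < x) :
    HasDerivAt (fun x : ℝ => x ^ a * (R.eval x * Real.exp (-x)))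
      (x ^ (a - 1) * Real.exp (-x) * (lagD a R).eval x) x := by
  have h1 := Real.hasDerivAt_rpow_const (x := x) (p := a) (Or.inl hx.ne')
  have h2 := R.hasDerivAt x
  have h3 : HasDerivAt (fun x : ℝ => Real.exp (-x)) (-Real.exp (-x)) x := by
    simpa using (hasDerivAt_neg x).exp
  refine (h1.mul (h2.mul h3)).congr_deriv ?_
  have : x ^ a = x ^ (a - 1) * x := by
    rw [Real.rpow_sub_one hx.ne']; field_simp
  simp only [lagD, Pi.mul_apply, eval_add, eval_sub, eval_mul, eval_X, eval_C]
  rw [this]; ring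

lemma lag_cont (a : ℝ) (ha : 0 < a) (R : ℝ[X]) :
    Continuous (fun x : ℝ => x ^ a * (R.eval x * Real.exp (-x))) := by
  have := Real.continuous_rpow_const ha.le
  have h2 := R.continuous
  fun_prop

lemma lag_tendsto (a : ℝ) (R : ℝ[X]) :
    Filter.Tendsto (fun x : ℝ => x ^ a * (R.eval x * Real.exp (-x))) Filter.atTop (nhds 0) := by
  induction R using Polynomial.induction_on' with
  | add p q hp hq =>
    have := hp.add hq
    rw [add_zero] at this
    refine this.congr fun x => ?_
    simp only [eval_add]; ring
  | monomial k c =>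
    have := (tendsto_rpow_mul_exp_neg_mul_atTop_nhds_zero (a + k) 1 one_pos).const_mul c
    rw [mul_zero] at this
    refine this.congr' ?_
    filter_upwards [Filter.eventually_gt_atTop 0] with x hx
    rw [Real.rpow_add hx, Real.rpow_natCast, eval_monomial]
    simp; ring

lemma lag_mvt (a : ℝ) (ha : 0 < a) (R : ℝ[X]) (d u v : ℝ) (hu : 0 ≤ u) (huv : u < v)
    (h : d * (u ^ a * (R.eval u * Real.exp (-u))) < d * (v ^ a * (R.eval v * Real.exp (-v)))) :
    ∃ z, u < z ∧ z < v ∧ 0 < d * (lagD a R).eval z := by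
  obtain ⟨z, hz, hz'⟩ := exists_hasDerivAt_eq_slope _ _ huv
    ((lag_cont a ha R).continuousOn) (fun x hx => lag_hasDeriv a R x (hu.trans_lt hx.1))
  refine ⟨z, hz.1, hz.2, ?_⟩
  have hz0 : 0 < z := hu.trans_lt hz.1
  have hp : 0 < z ^ (a - 1) * Real.exp (-z) := by positivity
  rw [eq_div_iff (sub_pos.2 huv).ne'] at hz'
  have : 0 < (d * (lagD a R).eval z) * (z ^ (a - 1) * Real.exp (-z) * (v - u)) := by
    have e : (d * (lagD a R).eval z) * (z ^ (a - 1) * Real.exp (-z) * (v - u)) =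
      d * (z ^ (a - 1) * Real.exp (-z) * (lagD a R).eval z * (v - u)) := by ring
    rw [e, hz']; linarith
  exact pos_of_mul_pos_left this (mul_pos hp (sub_pos.2 huv)).le

lemma Alt.step {m : ℕ} {R : ℝ[X]} (h : Alt m R) (a : ℝ) (ha : 0 < a) :
    Alt (m + 1) (lagD a R) := by
  obtain ⟨y, c, hy0, hy, hs⟩ := h
  set g : ℝ → ℝ := fun x : ℝ => x ^ a * (R.eval x * Real.exp (-x)) with hg
  have hgs : ∀ i ≤ m, 0 < c * (-1) ^ i * g (y i) := by
    intro i hi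
    have h1 := hs i hi
    have h2 : 0 < (y i) ^ a * Real.exp (-y i) :=
      mul_pos (Real.rpow_pos_of_pos (hy0 i hi) _) (Real.exp_pos _)
    have := mul_pos h1 h2
    simp only [hg]
    linarith
  have hY : ∃ Y, y m < Y ∧ c * (-1) ^ m * g Y < c * (-1) ^ m * g (y m) := by
    have ht := (lag_tendsto a R).const_mul (c * (-1) ^ m)
    rw [mul_zero] at ht
    exact ((Filter.eventually_gt_atTop (y m)).and
      (ht.eventually (gt_mem_nhds (hgs m le_rfl)))).exists
  obtain ⟨Y, hY1, hY2⟩ := hY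
  let w : ℕ → ℝ := fun i => if i = 0 then 0 else if i ≤ m + 1 then y (i - 1) else Y
  have hw0 : w 0 = 0 := by simp [w]
  have hws : ∀ i ≤ m, w (i + 1) = y i := by intro i hi; simp [w, hi]
  have hwl : w (m + 2) = Y := by simp [w]
  have key : ∀ i, ∃ z, i ≤ m + 1 →
      (w i < z ∧ z < w (i + 1) ∧ 0 < c * (-1) ^ i * (lagD a R).eval z) := by
    intro i
    by_cases hi : i ≤ m + 1
    swap
    · exact ⟨0, fun h => absurd h hi⟩
    have : 0 ≤ w i ∧ w i < w (i + 1) ∧ c * (-1) ^ i * g (w i) < c * (-1) ^ i * g (w (i + 1)) := by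
      rcases i with _ | i
      · rw [hw0, hws 0 (Nat.zero_le _)]
        refine ⟨le_rfl, hy0 0 (Nat.zero_le _), ?_⟩
        have h0 : g 0 = 0 := by simp [hg, Real.zero_rpow ha.ne']
        rw [h0, mul_zero]
        exact hgs 0 (Nat.zero_le _)
      · have him : i ≤ m := by omega
        rw [hws i him]
        refine ⟨(hy0 i him).le, ?_⟩
        have e1 := hgs i him
        rcases him.lt_or_eq with hlt | rfl
        · rw [hws (i + 1) hlt]
          refine ⟨hy i hlt, ?_⟩
          have e2 := hgs (i + 1) hlt
          rw [pow_succ] at e2 ⊢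
          linarith
        · rw [hwl]
          refine ⟨hY1, ?_⟩
          rw [pow_succ]
          linarith
    obtain ⟨z, hz⟩ := lag_mvt a ha R _ _ _ this.1 this.2.1 this.2.2
    exact ⟨z, fun _ => hz⟩
  choose z hz using key
  refine ⟨z, c, ?_, ?_, fun i hi => (hz i hi).2.2⟩
  · intro i hi
    refine lt_of_le_of_lt ?_ (hz i hi).1
    rcases i with _ | i
    · exact hw0.ge
    · rw [hws i (by omega)]; exact (hy0 i (by omega)).le
  · intro i hi
    exact (hz i hi.le).2.1.trans (hz (i + 1) hi).1

lemma alt_of_moments (S : Finset ℝ) : ∀ (P : ℝ[X]), P ≠ 0 → (∀ a ∈ S, 0 < a) →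
    (∀ a ∈ S, lagM a P = 0) → Alt S.card P := by
  induction S using Finset.induction_on with
  | empty =>
    intro P hP _ _
    obtain ⟨x, hx, hx'⟩ : ∃ x, 0 < x ∧ P.eval x ≠ 0 := by
      by_contra! hcon
      exact hP (Polynomial.eq_zero_of_infinite_isRoot P
        ((Set.Ioi_infinite (0 : ℝ)).mono fun x hx => hcon x hx))
    refine ⟨fun _ => x, P.eval x, fun _ _ => hx, fun i hi => by simp at hi, ?_⟩
    intro i hi
    have : i = 0 := by simpa using hi
    subst this
    simpa using hx'
  | insert a S haS ih =>
    intro P hP hpos hM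
    have ha := hpos a (mem_insert_self _ _)
    obtain ⟨R, rfl⟩ := lagD_surj a ha P (hM a (mem_insert_self _ _))
    have hR : R ≠ 0 := by rintro rfl; simp [lagD] at hP
    rw [Finset.card_insert_of_notMem haS]
    refine (ih R hR (fun b hb => hpos b (mem_insert_of_mem hb)) ?_).step a ha
    intro b hb
    have h1 := hM b (mem_insert_of_mem hb)
    rw [lagM_lagD a b (hpos b (mem_insert_of_mem hb))] at h1
    have hab : a - b ≠ 0 := by
      intro h; apply haS; rw [sub_eq_zero.1 h]; exact hb
    exact (mul_eq_zero.1 h1).resolve_left hab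

lemma alt_degree {m : ℕ} {P : ℝ[X]} (h : Alt m P) : P ≠ 0 ∧ m ≤ P.natDegree := by
  obtain ⟨y, c, hy0, hy, hs⟩ := h
  have hP : P ≠ 0 := by
    rintro rfl
    simpa using hs 0 (Nat.zero_le _)
  refine ⟨hP, ?_⟩
  have key : ∀ i, ∃ z, i < m → (y i < z ∧ z < y (i + 1) ∧ P.eval z = 0) := by
    intro i
    by_cases hi : i < m
    swap
    · exact ⟨0, fun h => absurd h hi⟩
    have h1 := hs i hi.le
    have h2 := hs (i + 1) hi
    have hcont : ContinuousOn (fun x => c * (-1) ^ i * P.eval x) (Set.Icc (y i) (y (i + 1))) := by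
      have := P.continuous
      fun_prop
    obtain ⟨z, hz, hz0⟩ := intermediate_value_Ioo' (hy i hi).le hcont
      (show (0 : ℝ) ∈ _ from ⟨by rw [pow_succ] at h2; linarith, h1⟩)
    refine ⟨z, fun _ => ⟨hz.1, hz.2, ?_⟩⟩
    refine (mul_eq_zero.1 hz0).resolve_left ?_
    intro h; rw [h] at h1; simp at h1
  choose z hz using key
  have hmono : StrictMonoOn y (Set.Iic m) := strictMonoOn_Iic_of_lt_succ (fun i hi => hy i hi)
  have hlt : ∀ i j, i < j → j < m → z i < z j := by
    intro i j hij hj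
    have h1 := (hz i (hij.trans hj)).2.1
    have h2 := (hz j hj).1
    have h3 : y (i + 1) ≤ y j := hmono.monotoneOn (by simp; omega) (by simp; omega) hij
    linarith
  have : (Finset.range m).card ≤ P.roots.toFinset.card := by
    apply Finset.card_le_card_of_injOn z
    · intro i hi
      have hi : i < m := by simpa using hi
      simp [hP, (hz i hi).2.2]
    · intro i hi j hj hij
      have hi : i < m := by simpa using hi
      have hj : j < m := by simpa using hj
      rcases lt_trichotomy i j with h | h | h
      · exact absurd hij (hlt i j h hj).ne
      · exact h
      · exact absurd hij (hlt j i h hi).ne'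
  rw [Finset.card_range] at this
  exact this.trans ((Multiset.toFinset_card_le _).trans P.card_roots')

lemma no_double_root {m : ℕ} {P : ℝ[X]} (h : Alt m P) (hd : P.natDegree ≤ m + 1) (x : ℝ)
    (h0 : P.eval x = 0) (h1 : (derivative P).eval x = 0) : False := by
  have hP := (alt_degree h).1
  obtain ⟨Q, hQ⟩ : (X - C x) ^ 2 ∣ P := by
    rw [← Polynomial.le_rootMultiplicity_iff hP]
    exact (Polynomial.one_lt_rootMultiplicity_iff_isRoot hP).2 ⟨h0, h1⟩
  have hQ0 : Q ≠ 0 := by rintro rfl; simp at hQ; exact hP hQ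
  have hdeg : P.natDegree = 2 + Q.natDegree := by
    rw [hQ, natDegree_mul (pow_ne_zero _ (X_sub_C_ne_zero x)) hQ0, natDegree_pow, natDegree_X_sub_C]
  have hA : Alt m Q := by
    obtain ⟨y, c, hy0, hy, hs⟩ := h
    refine ⟨y, c, hy0, hy, fun i hi => ?_⟩
    have := hs i hi
    rw [hQ, eval_mul] at this
    have h2 : 0 ≤ eval (y i) ((X - C x) ^ 2) := by simp; positivity
    refine pos_of_mul_pos_left ?_ h2
    linarith
  have := (alt_degree hA).2
  omega

lemma lag_integral (α : ℝ) (hα : -1 < α) (k : ℕ) (P : ℝ[X]) :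
    IntegrableOn (fun x : ℝ => x ^ k * P.eval x * (x ^ α * Real.exp (-x))) (Set.Ioi 0) ∧
    ∫ x in Set.Ioi (0 : ℝ), x ^ k * P.eval x * (x ^ α * Real.exp (-x)) = lagM (α + k + 1) P := by
  induction P using Polynomial.induction_on' with
  | add p q hp hq =>
    have e : (fun x : ℝ => x ^ k * (p + q).eval x * (x ^ α * Real.exp (-x))) =
      fun x => x ^ k * p.eval x * (x ^ α * Real.exp (-x)) +
        x ^ k * q.eval x * (x ^ α * Real.exp (-x)) := by
      ext x; rw [eval_add]; ring
    rw [e, map_add, ← hp.2, ← hq.2]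
    exact ⟨hp.1.add hq.1, integral_add hp.1 hq.1⟩
  | monomial n c =>
    have hs : 0 < α + k + 1 + n := by
      have : (0 : ℝ) ≤ k := by positivity
      have : (0 : ℝ) ≤ n := by positivity
      linarith
    have e : Set.EqOn (fun x : ℝ => c * (Real.exp (-x) * x ^ (α + k + 1 + n - 1)))
        (fun x : ℝ => x ^ k * (monomial n c).eval x * (x ^ α * Real.exp (-x))) (Set.Ioi 0) := by
      intro x hx
      have hx : 0 < x := hx
      have : α + k + 1 + n - 1 = α + (k : ℝ) + n := by ring
      simp only [eval_monomial]
      rw [this, Real.rpow_add hx, Real.rpow_add hx, Real.rpow_natCast, Real.rpow_natCast]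
      ring
    constructor
    · exact IntegrableOn.congr_fun ((Real.GammaIntegral_convergent hs).const_mul c) e
        measurableSet_Ioi
    · rw [← setIntegral_congr_fun measurableSet_Ioi e, integral_const_mul,
        ← Real.Gamma_eq_integral hs, lagM_monomial, mul_comm]

lemma alt_of_orth {r : ℕ} (α : Fin r → ℝ) (hα : ∀ i, -1 < α i)
    (hαZ : ∀ i j : Fin r, i ≠ j → ∀ z : ℤ, α i - α j ≠ (z : ℝ)) (n : Fin r → ℕ)
    (P : ℝ[X]) (hP : P ≠ 0) (h : ∀ j, ∀ k < n j, lagM (α j + k + 1) P = 0) :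
    Alt (∑ i, n i) P := by
  classical
  let f : (Σ j : Fin r, Fin (n j)) → ℝ := fun s => α s.1 + (s.2 : ℕ) + 1
  have hf : Function.Injective f := by
    rintro ⟨i, a⟩ ⟨j, b⟩ hab
    simp only [f] at hab
    by_cases hij : i = j
    · subst hij
      have : ((a : ℕ) : ℝ) = (b : ℕ) := by linarith
      have : a = b := Fin.ext (by exact_mod_cast this)
      rw [this]
    · exfalso
      apply hαZ i j hij (((b : ℕ) : ℤ) - ((a : ℕ) : ℤ))
      push_cast; linarith
  have hc : (Finset.univ.image f).card = ∑ i, n i := by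
    rw [Finset.card_image_of_injective _ hf]
    simp
  rw [← hc]
  apply alt_of_moments _ _ hP
  · intro a ha
    obtain ⟨s, -, rfl⟩ := Finset.mem_image.1 ha
    have := hα s.1
    have : (0 : ℝ) ≤ (s.2 : ℕ) := by positivity
    simp only [f]; linarith
  · intro a ha
    obtain ⟨s, -, rfl⟩ := Finset.mem_image.1 ha
    exact h s.1 s.2 s.2.2

/-- the multiple Laguerre polynomials of the first kind satisfy
`x (L^{α}_{n}(x) (L^{α}_{n+e_k})′(x) − (L^{α}_{n})′(x) L^{α}_{n+e_k}(x)) > 0` for all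
`x > 0`; i.e. the 2×2 determinant with rows `(L_n, L_{n+e_k})` and
`(x L_n′, x L_{n+e_k}′)` is strictly positive for `x > 0`. -/
theorem multipleLaguerreI_wronskian_pos {r : ℕ} (hr : 1 ≤ r)
    (α : Fin r → ℝ) (hα : ∀ i, -1 < α i)
    (hαZ : ∀ i j : Fin r, i ≠ j → ∀ z : ℤ, α i - α j ≠ (z : ℝ))
    (L : (Fin r → ℕ) → Polynomial ℝ)
    (hL : ∀ n, IsMultipleLaguerreI α n (L n))
    (n : Fin r → ℕ) (k : Fin r) (x : ℝ) (hx : 0 < x) :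
    0 < x * ((L n).eval x * ((L (n + unitMI k)).derivative).eval x -
        ((L n).derivative).eval x * (L (n + unitMI k)).eval x) := by
  set N := ∑ i, n i with hN
  set p := L n with hp
  set q := L (n + unitMI k) with hq
  obtain ⟨pm, pd, po⟩ := hL n
  obtain ⟨qm, qd, qo⟩ := hL (n + unitMI k)
  rw [← hp] at pm pd po
  rw [← hq] at qm qd qo
  have hqd : q.natDegree = N + 1 := by
    rw [qd]; simp [Finset.sum_add_distrib, unitMI, hN]
  rw [← hN] at pd
  have nz : ∀ x : ℝ, 0 < x → x * (p.eval x * (derivative q).eval x -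
      (derivative p).eval x * q.eval x) ≠ 0 := by
    intro t ht h0
    have hW := (mul_eq_zero.1 h0).resolve_left ht.ne'
    have main : ∀ A B : ℝ, (A ≠ 0 ∨ B ≠ 0) → A * p.eval t + B * q.eval t = 0 →
        A * (derivative p).eval t + B * (derivative q).eval t = 0 → False := by
      intro A B hAB e0 e1
      have hne : C A * p + C B * q ≠ 0 := by
        intro hz
        have hB : B = 0 := by
          have := congrArg (fun s => coeff s (N + 1)) hz
          simp only [coeff_add, coeff_C_mul, coeff_zero] at this
          rw [coeff_eq_zero_of_natDegree_lt (by omega), ← hqd, qm.coeff_natDegree] at this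
          simpa using this
        subst hB
        have hA : A = 0 := by
          have := congrArg (fun s => coeff s N) hz
          simp only [coeff_add, coeff_C_mul, coeff_zero] at this
          rw [← pd, pm.coeff_natDegree] at this
          simpa using this
        simp [hA] at hAB
      have hA : Alt N (C A * p + C B * q) := by
        refine alt_of_orth α hα hαZ n _ hne fun j l hl => ?_
        have h1 := po j l hl
        have h2 := qo j l (lt_of_lt_of_le hl (by simp))
        rw [(lag_integral _ (hα j) _ _).2] at h1 h2
        rw [← smul_eq_C_mul, ← smul_eq_C_mul, map_add, map_smul, map_smul, h1, h2]
        simp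
      refine no_double_root hA ?_ t ?_ ?_
      · refine (natDegree_add_le _ _).trans (max_le ?_ ?_)
        · exact (natDegree_C_mul_le _ _).trans (by omega)
        · exact (natDegree_C_mul_le _ _).trans (by omega)
      · simpa using e0
      · simpa using e1
    by_cases hpq : q.eval t = 0 ∧ p.eval t = 0
    · by_cases hpq' : (derivative q).eval t = 0
      · exact main 0 1 (by simp) (by simp [hpq.1]) (by simp [hpq'])
      · refine main ((derivative q).eval t) (-(derivative p).eval t) (Or.inl hpq') ?_ ?_
        · rw [hpq.1, hpq.2]; ring
        · ring
    · refine main (q.eval t) (-p.eval t) ?_ ?_ ?_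
      · rw [neg_ne_zero]; tauto
      · ring
      · linarith
  set F : ℝ[X] := X * (p * derivative q - derivative p * q) with hF
  have hFe : ∀ t, F.eval t = t * (p.eval t * (derivative q).eval t -
      (derivative p).eval t * q.eval t) := by intro t; simp [hF]
  have pc : p.coeff N = 1 := by rw [← pd]; exact pm.coeff_natDegree
  have qc : q.coeff (N + 1) = 1 := by rw [← hqd]; exact qm.coeff_natDegree
  have c1 : (p * derivative q).coeff (N + N) = N + 1 := by
    rw [coeff_mul_add_eq_of_natDegree_le pd.le (by
      have := natDegree_derivative_le q
      omega), coeff_derivative, qc, pc]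
    simp
  have c2 : (derivative p * q).coeff (N + N) = N := by
    rcases Nat.eq_zero_or_pos N with h0 | h0
    · have : derivative p = 0 := by
        rw [derivative_of_natDegree_zero]; omega
      simp [this, h0]
    · obtain ⟨M, hM⟩ : ∃ M, N = M + 1 := ⟨N - 1, by omega⟩
      have : N + N = M + (N + 1) := by omega
      rw [this, coeff_mul_add_eq_of_natDegree_le (by
        have := natDegree_derivative_le p
        omega) hqd.le, coeff_derivative, ← hM, qc, pc, hM]
      simp
  have cF : F.coeff (N + N + 1) = 1 := by
    rw [hF, coeff_X_mul, coeff_sub, c1, c2]; ring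
  have dF : F.natDegree ≤ N + N + 1 := by
    have d1 := natDegree_derivative_le q
    have d2 := natDegree_derivative_le p
    have : (p * derivative q - derivative p * q).natDegree ≤ N + N := by
      refine (natDegree_sub_le _ _).trans (max_le ?_ ?_)
      · exact natDegree_mul_le.trans (by omega)
      · rcases Nat.eq_zero_or_pos N with h0 | h0
        · have : derivative p = 0 := by
            rw [derivative_of_natDegree_zero]; omega
          simp [this]
        · exact natDegree_mul_le.trans (by omega)
    rw [hF]
    refine natDegree_mul_le.trans ?_
    rw [natDegree_X]; omega
  have dF' : F.natDegree = N + N + 1 :=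
    le_antisymm dF (le_natDegree_of_ne_zero (by rw [cF]; exact one_ne_zero))
  have ht : Filter.Tendsto (fun t => F.eval t) Filter.atTop Filter.atTop := by
    apply Polynomial.tendsto_atTop_of_leadingCoeff_nonneg
    · rw [← natDegree_pos_iff_degree_pos]; omega
    · rw [leadingCoeff, dF', cF]; exact zero_le_one
  obtain ⟨Y, hY1, hY2⟩ := ((Filter.eventually_gt_atTop x).and
    (ht.eventually (Filter.eventually_gt_atTop 0))).exists
  rw [← hFe]
  by_contra hcon
  rw [not_lt] at hcon
  obtain ⟨z, hz, hz0⟩ := intermediate_value_Icc hY1.le F.continuous.continuousOn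
    (show (0 : ℝ) ∈ _ from ⟨hcon, hY2.le⟩)
  exact nz z (hx.trans_le hz.1) (by rw [← hFe]; exact hz0)
end
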